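/- Let μ ∈ C([0,∞); P₂^ν(ℝ²)) be a global measure-valued solution of the nonlocal continuity equation with initial datum μ₀. If μ₀ is a Borel (respectively continuous, respectively C¹) graph measure, μ₀ = (G₀ ⊗ Id)_♯ ν, then for every t ≥ 0 the measure μ_t is a Borel (respectively continuous, respectively C¹) graph measure; explicitly, μ_t = (G_t ⊗ Id)_♯ ν with G_t(ω) = X(t, G₀(ω), ω), where X is the characteristic flow. -/

import Mathlib

set_option autoImplicit false

open MeasureTheory Set Real Filter

noncomputable section

/-- The (topological) support of a measure: points all of whose open neighborhoods
have positive measure. -/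
def msupp {E : Type*} [TopologicalSpace E] [MeasurableSpace E] (μ : Measure E) : Set E :=
  {z | ∀ U : Set E, IsOpen U → z ∈ U → μ U ≠ 0}

/-- `pl` is a coupling of `μ` and `ν`. -/
def IsCoupling {E F : Type*} [MeasurableSpace E] [MeasurableSpace F]
    (pl : Measure (E × F)) (μ : Measure E) (ν : Measure F) : Prop :=
  pl.map Prod.fst = μ ∧ pl.map Prod.snd = ν

/-- The 1-Wasserstein distance. -/
def W1 {E : Type*} [MeasurableSpace E] [PseudoMetricSpace E] (μ ν : Measure E) : ℝ :=
  ⨅ pl : {pl : Measure (E × E) // IsCoupling pl μ ν}, ∫ q, dist q.1 q.2 ∂(pl.1)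

/-- The 2-Wasserstein distance. -/
def W2 {E : Type*} [MeasurableSpace E] [PseudoMetricSpace E] (μ ν : Measure E) : ℝ :=
  ⨅ pl : {pl : Measure (E × E) // IsCoupling pl μ ν},
    Real.sqrt (∫ q, dist q.1 q.2 ^ 2 ∂(pl.1))

/-- Partial derivative `∂ₓ F[μ](x,ω)` of a nonlocal velocity field. -/
def Fx (F : Measure (ℝ × ℝ) → ℝ × ℝ → ℝ) (μ : Measure (ℝ × ℝ)) (z : ℝ × ℝ) : ℝ :=
  deriv (fun x => F μ (x, z.2)) z.1

/-- Second partial derivative `∂ₓ² F[μ](x,ω)`. -/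
def Fxx (F : Measure (ℝ × ℝ) → ℝ × ℝ → ℝ) (μ : Measure (ℝ × ℝ)) (z : ℝ × ℝ) : ℝ :=
  deriv (fun x => Fx F μ (x, z.2)) z.1

/-- Partial derivative `∂_ω F[μ](x,ω)`. -/
def Fw (F : Measure (ℝ × ℝ) → ℝ × ℝ → ℝ) (μ : Measure (ℝ × ℝ)) (z : ℝ × ℝ) : ℝ :=
  deriv (fun w => F μ (z.1, w)) z.2

/-- The spatial average (barycenter) `x_c[μ] = ∫ x μ(dx,dω)`. -/
def xc (μ : Measure (ℝ × ℝ)) : ℝ := ∫ z, z.1 ∂μ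

/-- The mean frequency `ω_c = ∫ ω ν(dω)`. -/
def wc (ν : Measure ℝ) : ℝ := ∫ ω, ω ∂ν

/-- The measure `δ_x ⊗ ν`. -/
def diracProd (x : ℝ) (ν : Measure ℝ) : Measure (ℝ × ℝ) := (Measure.dirac x).prod ν

/-- `P₂^ν(ℝ²)`: probability measures on `ℝ²` with finite second moment and
`ω`-marginal `ν`. -/
def P2nu (ν : Measure ℝ) : Set (Measure (ℝ × ℝ)) :=
  {μ | IsProbabilityMeasure μ ∧ Integrable (fun z : ℝ × ℝ => z.1 ^ 2 + z.2 ^ 2) μ ∧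
    μ.map Prod.snd = ν}

/-- The diameter in `x` of the support of `μ`. -/
def diamx (μ : Measure (ℝ × ℝ)) : ℝ :=
  sSup {d : ℝ | ∃ z ∈ msupp μ, ∃ z' ∈ msupp μ, d = |z.1 - z'.1|}

/-- The structural assumptions `(A1)–(A5)` defining the class `F^ν_{A,B,I,M}(κ,γ)`. -/
structure Framework (ν : Measure ℝ) (F : Measure (ℝ × ℝ) → ℝ × ℝ → ℝ)
    (A B I M κ γ : ℝ) : Prop where
  /-- (A1) mean-field regularity -/
  hA1 : ∀ μ ∈ P2nu ν, ∀ μ' ∈ P2nu ν, ∀ x : ℝ, ∀ ω ∈ msupp ν,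
    |F μ (x, ω) - F μ' (x, ω)| ≤ κ * M * W1 μ μ' ∧
    |Fx F μ (x, ω) - Fx F μ' (x, ω)| ≤ κ * M * W1 μ μ'
  /-- (A2) space regularity -/
  hA2 : ∀ μ ∈ P2nu ν, ContDiff ℝ 2 (F μ) ∧
    (∀ z : ℝ × ℝ, |Fx F μ z| ≤ κ * I) ∧ (∀ z : ℝ × ℝ, |Fxx F μ z| ≤ κ * I) ∧
    (∀ z : ℝ × ℝ, |Fw F μ z| ≤ I)
  /-- (A3) lifted periodicity -/
  hA3 : ∀ μ ∈ P2nu ν, ∀ z : ℝ × ℝ,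
    F (μ.map fun w : ℝ × ℝ => (w.1 + 2 * π, w.2)) (z.1 + 2 * π, z.2) = F μ z
  /-- (A4) no stationarity -/
  hA4 : ∀ x : ℝ, A ≤ F (diracProd x ν) (x, wc ν)
  /-- (A5) synchronization -/
  hA5 : (∫ x in (0:ℝ)..(2 * π),
      Fx F (diracProd x ν) (x, wc ν) / F (diracProd x ν) (x, wc ν)) ≤ -(κ * B)

/-- `μ` is a measure-valued solution of the nonlocal continuity equation
`∂ₜ μ + ∂ₓ (F[μ] μ) = 0` on `[0,∞)`. -/
def IsSol (F : Measure (ℝ × ℝ) → ℝ × ℝ → ℝ) (μ : ℝ → Measure (ℝ × ℝ)) : Prop :=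
  (∀ φ : ℝ × ℝ → ℝ, Continuous φ → HasCompactSupport φ →
    ContinuousOn (fun t => ∫ z, φ z ∂(μ t)) (Ici 0)) ∧
  (∀ φ : ℝ → ℝ × ℝ → ℝ,
    ContDiff ℝ 1 (fun q : ℝ × (ℝ × ℝ) => φ q.1 q.2) →
    HasCompactSupport (fun q : ℝ × (ℝ × ℝ) => φ q.1 q.2) →
    ∀ t : ℝ, 0 ≤ t →
      ∫ z, φ t z ∂(μ t) = (∫ z, φ 0 z ∂(μ 0)) +
        ∫ s in (0:ℝ)..t, ∫ z, (deriv (fun u => φ u z) s +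
          F (μ s) z * deriv (fun x => φ s (x, z.2)) z.1) ∂(μ s))

/-- `X` is the characteristic flow associated with a solution `μ`:
`dX/dt = F[μ_t](X(t,x,ω),ω)`, `X(0,x,ω) = x`. -/
def IsFlow (F : Measure (ℝ × ℝ) → ℝ × ℝ → ℝ) (μ : ℝ → Measure (ℝ × ℝ))
    (X : ℝ → ℝ → ℝ → ℝ) : Prop :=
  (∀ x ω : ℝ, X 0 x ω = x) ∧
  ∀ x ω t : ℝ, 0 ≤ t → HasDerivAt (fun τ => X τ x ω) (F (μ t) (X t x ω, ω)) t

/-- `K` is a disintegration of `μ` with respect to the `ω`-marginal `ν`. -/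
def IsDisint (ν : Measure ℝ) (μ : Measure (ℝ × ℝ)) (K : ℝ → Measure ℝ) : Prop :=
  (∀ ω, IsProbabilityMeasure (K ω)) ∧
  μ = ν.bind fun ω => (K ω).map fun x => (x, ω)

/-- The constant `C₁(κ,γ,D) = κ(M+I)D² + 2Iγ`. -/
def C1 (I M κ γ D : ℝ) : ℝ := κ * (M + I) * D ^ 2 + 2 * I * γ

/-- The constant `C₂(κ,γ,D)`. -/
def C2 (A I M κ γ D : ℝ) : ℝ :=
  C1 I M κ γ D / A +
    (((κ + 1) * I + κ * M) * D + I * γ) * (κ * I * D + C1 I M κ γ D) /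
      (A * (A - ((κ + 1) * I + κ * M) * D - I * γ))

/-- The constant `E₁(κ,γ,D) = κ (D (3I/2 + M) + Iγ)`. -/
def E1 (I M κ γ D : ℝ) : ℝ := κ * (D * (3 * I / 2 + M) + I * γ)

/-- The constant `E₂(κ,γ,D)`. -/
def E2 (A I M κ γ D : ℝ) : ℝ :=
  κ / (A - ((κ + 1) * I + κ * M) * D - I * γ) *
    (D * (3 * I / 2 + M) + I * γ + I * (κ * (I + M) * D + I * γ) / A)

/-- Membership in `C_ν^{(1)}(Δ)`. -/
def MemC1 (ν : Measure ℝ) (Δ : ℝ → ℝ) (μ : Measure (ℝ × ℝ)) : Prop :=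
  μ ∈ P2nu ν ∧ diamx μ ≤ Δ (xc μ)

/-- Membership in `C_ν(Δ,Δ̃)`. -/
def MemC (ν : Measure ℝ) (Δ Δ' : ℝ → ℝ) (μ : Measure (ℝ × ℝ)) : Prop :=
  μ ∈ P2nu ν ∧ diamx μ ≤ Δ (xc μ) ∧
  ∃ K : ℝ → Measure ℝ, IsDisint ν μ K ∧
    ∀ ω ∈ msupp ν, ∀ ω' ∈ msupp ν, W2 (K ω) (K ω') ≤ Δ' (xc μ) * |ω - ω'|

/-- The metric `d₁` computed from disintegrations. -/
def d1k (ν : Measure ℝ) (K K' : ℝ → Measure ℝ) : ℝ := ∫ ω, W1 (K ω) (K' ω) ∂ν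

/-- The metric `d₂` computed from disintegrations. -/
def d2k (ν : Measure ℝ) (K K' : ℝ → Measure ℝ) : ℝ :=
  Real.sqrt (∫ ω, W2 (K ω) (K' ω) ^ 2 ∂ν)

/-- A flow `X` of a time-dependent field `V`, Lipschitz in `(x, ω)` uniformly in time. -/
structure LipFlow (V : ℝ → ℝ × ℝ → ℝ) (X : ℝ → ℝ → ℝ → ℝ) (c L : ℝ) : Prop where
  c_pos : 0 < c
  L_nonneg : 0 ≤ L
  lip : ∀ t, 0 ≤ t → ∀ z z' : ℝ × ℝ, |V t z - V t z'| ≤ c * |z.1 - z'.1| + L * |z.2 - z'.2|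
  init : ∀ x ω, X 0 x ω = x
  ode : ∀ x ω t, 0 ≤ t → HasDerivAt (fun τ => X τ x ω) (V t (X t x ω, ω)) t

/-- A common Lipschitz constant of the maps `X t`, `0 ≤ t ≤ T`. -/
def flowConst (c L T : ℝ) : ℝ := (1 + L / c) * exp (c * T)

lemma flowConst_nonneg {c L : ℝ} (hc : 0 < c) (hL : 0 ≤ L) (T : ℝ) : 0 ≤ flowConst c L T := by
  unfold flowConst; positivity

namespace LipFlow

variable {V : ℝ → ℝ × ℝ → ℝ} {X : ℝ → ℝ → ℝ → ℝ} {c L : ℝ}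

lemma abs_sub_le (h : LipFlow V X c L) {T t : ℝ} (ht : t ∈ Icc 0 T) (x ω x' ω' : ℝ) :
    |X t x ω - X t x' ω'| ≤ flowConst c L T * (|x - x'| + |ω - ω'|) := by
  have hc := h.c_pos
  have hL := h.L_nonneg
  have key := norm_le_gronwallBound_of_norm_deriv_right_le
    (f := fun s => X s x ω - X s x' ω')
    (f' := fun s => V s (X s x ω, ω) - V s (X s x' ω', ω'))
    (δ := |x - x'|) (K := c) (ε := L * |ω - ω'|) (a := 0) (b := T)
    (fun s hs => ((h.ode x ω s hs.1).sub (h.ode x' ω' s hs.1)).continuousAt.continuousWithinAt)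
    (fun s hs => ((h.ode x ω s hs.1).sub (h.ode x' ω' s hs.1)).hasDerivWithinAt)
    (by simp [h.init])
    (fun s hs => h.lip s hs.1 _ _) t ht
  refine key.trans ?_
  rw [gronwallBound_of_K_ne_0 hc.ne']
  have e1 : exp (c * (t - 0)) ≤ exp (c * T) := by
    apply exp_le_exp.2; have := ht.2; nlinarith
  have e0 : 0 < exp (c * T) := exp_pos _
  have a1 := abs_nonneg (x - x')
  have a2 := abs_nonneg (ω - ω')
  have a3 : 0 ≤ L / c := by positivity
  have : L * |ω - ω'| / c = L / c * |ω - ω'| := by ring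
  rw [this]
  unfold flowConst
  have b1 : |x - x'| * exp (c * (t - 0)) ≤ |x - x'| * exp (c * T) := by gcongr
  have b2 : L / c * |ω - ω'| * (exp (c * (t - 0)) - 1) ≤ L / c * |ω - ω'| * exp (c * T) := by
    gcongr; linarith
  have b3 : 0 ≤ L / c * exp (c * T) * |x - x'| := by positivity
  have b4 : 0 ≤ exp (c * T) * |ω - ω'| := by positivity
  nlinarith

lemma continuous (h : LipFlow V X c L) {t : ℝ} (ht : 0 ≤ t) :
    Continuous fun p : ℝ × ℝ => X t p.1 p.2 := by
  rw [continuous_iff_continuousAt]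
  intro p
  rw [ContinuousAt, tendsto_iff_dist_tendsto_zero]
  refine squeeze_zero (fun _ => dist_nonneg)
    (fun q => h.abs_sub_le (T := t) ⟨ht, le_rfl⟩ q.1 q.2 p.1 p.2) ?_
  have : Continuous fun q : ℝ × ℝ => flowConst c L t * (|q.1 - p.1| + |q.2 - p.2|) := by fun_prop
  simpa using this.tendsto p

lemma continuousOn_time (h : LipFlow V X c L) (x ω T : ℝ) :
    ContinuousOn (fun s => X s x ω) (Icc 0 T) :=
  fun s hs => (h.ode x ω s hs.1).continuousAt.continuousWithinAt

end LipFlow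

/-- A function whose logarithmic derivative is at most `c` does not decay faster than `exp (-c t)`. -/
lemma le_of_abs_deriv_le {u u' : ℝ → ℝ} {c T : ℝ}
    (hu : ∀ t ∈ Icc 0 T, HasDerivAt u (u' t) t)
    (hb : ∀ t ∈ Icc 0 T, |u' t| ≤ c * |u t|) (h0 : 0 < u 0) {t : ℝ} (ht : t ∈ Icc 0 T) :
    u 0 * exp (-c * t) ≤ u t := by
  have hder : ∀ s ∈ Icc 0 T, HasDerivAt (fun s => u s ^ 2 * exp (2 * c * s))
      ((2 * u s * u' s + 2 * c * u s ^ 2) * exp (2 * c * s)) s := by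
    intro s hs
    have h1 := (hu s hs).pow 2
    have h2 : HasDerivAt (fun s => exp (2 * c * s)) (exp (2 * c * s) * (2 * c)) s := by
      simpa using ((hasDerivAt_id s).const_mul (2 * c)).exp
    refine (h1.mul h2).congr_deriv ?_
    simp; ring
  have hmono : MonotoneOn (fun s => u s ^ 2 * exp (2 * c * s)) (Icc 0 T) := by
    refine monotoneOn_of_deriv_nonneg (convex_Icc _ _)
      (fun s hs => (hder s hs).continuousAt.continuousWithinAt)
      (fun s hs => (hder s (interior_subset hs)).differentiableAt.differentiableWithinAt) ?_
    intro s hs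
    rw [(hder s (interior_subset hs)).deriv]
    have := hb s (interior_subset hs)
    have h3 : |u s * u' s| ≤ c * u s ^ 2 := by
      rw [abs_mul, ← sq_abs (u s)]; nlinarith [abs_nonneg (u s)]
    have h4 := (abs_le.1 h3).1
    have : 0 ≤ 2 * u s * u' s + 2 * c * u s ^ 2 := by nlinarith
    positivity
  have hsq : ∀ s ∈ Icc 0 T, (u 0 * exp (-c * s)) ^ 2 ≤ u s ^ 2 := by
    intro s hs
    have := hmono ⟨le_rfl, hs.1.trans hs.2⟩ hs hs.1
    simp only [mul_zero, exp_zero, mul_one] at this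
    have e : exp (-c * s) ^ 2 * exp (2 * c * s) = 1 := by
      rw [← exp_nat_mul, ← exp_add]; simp; ring
    have e2 : 0 < exp (-c * s) ^ 2 := by positivity
    calc (u 0 * exp (-c * s)) ^ 2 = u 0 ^ 2 * exp (-c * s) ^ 2 := by ring
      _ ≤ (u s ^ 2 * exp (2 * c * s)) * exp (-c * s) ^ 2 := by gcongr
      _ = u s ^ 2 * (exp (-c * s) ^ 2 * exp (2 * c * s)) := by ring
      _ = u s ^ 2 := by rw [e, mul_one]
  have hpos : 0 < u t := by
    by_contra hneg
    push Not at hneg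
    have hcont : ContinuousOn u (Icc 0 t) := fun s hs =>
      (hu s ⟨hs.1, hs.2.trans ht.2⟩).continuousAt.continuousWithinAt
    obtain ⟨s, hs, hs0⟩ := intermediate_value_Icc' ht.1 hcont ⟨hneg, h0.le⟩
    have := hsq s ⟨hs.1, hs.2.trans ht.2⟩
    rw [hs0] at this
    have : 0 < (u 0 * exp (-c * s)) ^ 2 := by positivity
    nlinarith
  exact (le_abs_self _).trans (abs_le_of_sq_le_sq (hsq t ht) hpos.le)

namespace LipFlow

variable {V : ℝ → ℝ × ℝ → ℝ} {X : ℝ → ℝ → ℝ → ℝ} {c L : ℝ}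

/-- The `x`-derivative of the field along the flow. -/
def coefX (V : ℝ → ℝ × ℝ → ℝ) (X : ℝ → ℝ → ℝ → ℝ) (p : ℝ × ℝ) (s : ℝ) : ℝ :=
  fderiv ℝ (V s) (X s p.1 p.2, p.2) (1, 0)

/-- The `ω`-derivative of the field along the flow. -/
def coefW (V : ℝ → ℝ × ℝ → ℝ) (X : ℝ → ℝ → ℝ → ℝ) (p : ℝ × ℝ) (s : ℝ) : ℝ :=
  fderiv ℝ (V s) (X s p.1 p.2, p.2) (0, 1)

/-- The `x`-derivative of the flow. -/
def jacX (V : ℝ → ℝ × ℝ → ℝ) (X : ℝ → ℝ → ℝ → ℝ) (p : ℝ × ℝ) (t : ℝ) : ℝ :=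
  exp (∫ s in (0:ℝ)..t, coefX V X p s)

lemma abs_le_of_hasFDerivAt {f : ℝ × ℝ → ℝ} {f' : ℝ × ℝ →L[ℝ] ℝ} {z v : ℝ × ℝ} {C : ℝ}
    (hf : HasFDerivAt f f' z) (hC : 0 ≤ C)
    (hb : ∀ r : ℝ, |f (z + r • v) - f z| ≤ C * |r|) : |f' v| ≤ C := by
  have hd : HasDerivAt (fun r : ℝ => f (z + r • v)) (f' v) 0 := by
    have h1 : HasDerivAt (fun r : ℝ => z + r • v) v 0 := by
      simpa using ((hasDerivAt_id (0:ℝ)).smul_const v).const_add z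
    have h2 : HasFDerivAt f f' (z + (0:ℝ) • v) := by simpa using hf
    exact h2.comp_hasDerivAt 0 h1
  have := hd.le_of_lip' hC (Eventually.of_forall fun r => by simpa using hb r)
  simpa using this

lemma abs_coefX_le (h : LipFlow V X c L)
    (hV : ∀ t, 0 ≤ t → ContDiff ℝ 1 (V t)) (p : ℝ × ℝ) {s : ℝ} (hs : 0 ≤ s) :
    |coefX V X p s| ≤ c := by
  refine abs_le_of_hasFDerivAt (((hV s hs).differentiable one_ne_zero _).hasFDerivAt)
    h.c_pos.le fun r => ?_
  simpa using h.lip s hs ((X s p.1 p.2, p.2) + r • ((1:ℝ), (0:ℝ))) (X s p.1 p.2, p.2)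

lemma abs_coefW_le (h : LipFlow V X c L)
    (hV : ∀ t, 0 ≤ t → ContDiff ℝ 1 (V t)) (p : ℝ × ℝ) {s : ℝ} (hs : 0 ≤ s) :
    |coefW V X p s| ≤ L := by
  refine abs_le_of_hasFDerivAt (((hV s hs).differentiable one_ne_zero _).hasFDerivAt)
    h.L_nonneg fun r => ?_
  simpa using h.lip s hs ((X s p.1 p.2, p.2) + r • ((0:ℝ), (1:ℝ))) (X s p.1 p.2, p.2)

lemma continuous_coefX (h : LipFlow V X c L)
    (hV : ∀ t, 0 ≤ t → ContDiff ℝ 1 (V t)) {s : ℝ} (hs : 0 ≤ s) :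
    Continuous fun p => coefX V X p s := by
  unfold coefX
  exact (((hV s hs).continuous_fderiv one_ne_zero).comp
    ((h.continuous hs).prodMk continuous_snd)).clm_apply continuous_const

lemma continuous_coefW (h : LipFlow V X c L)
    (hV : ∀ t, 0 ≤ t → ContDiff ℝ 1 (V t)) {s : ℝ} (hs : 0 ≤ s) :
    Continuous fun p => coefW V X p s := by
  unfold coefW
  exact (((hV s hs).continuous_fderiv one_ne_zero).comp
    ((h.continuous hs).prodMk continuous_snd)).clm_apply continuous_const

/-- The linearised equation along the flow. -/
lemma tendsto_linearization (h : LipFlow V X c L)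
    (hV : ∀ t, 0 ≤ t → ContDiff ℝ 1 (V t)) (p : ℝ × ℝ) {s : ℝ}
    (hs : 0 ≤ s) {ι : Type*} {l : Filter ι} {q : ι → ℝ × ℝ} {n : ι → ℝ}
    (hq : Tendsto q l (nhds p)) (hn : ∀ i, |(q i).1 - p.1| + |(q i).2 - p.2| ≤ 2 * n i) :
    Tendsto (fun i => (V s (X s (q i).1 (q i).2, (q i).2) - V s (X s p.1 p.2, p.2)
      - coefX V X p s * (X s (q i).1 (q i).2 - X s p.1 p.2)
      - coefW V X p s * ((q i).2 - p.2)) / n i) l (nhds 0) := by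
  have hd := ((hV s hs).differentiable one_ne_zero (X s p.1 p.2, p.2)).hasFDerivAt.isLittleO
  have hcont : Tendsto (fun i => (X s (q i).1 (q i).2, (q i).2)) l
      (nhds (X s p.1 p.2, p.2)) :=
    (((h.continuous hs).prodMk continuous_snd).tendsto p).comp hq
  have h1 := hd.comp_tendsto hcont
  have h2 : ((fun x' => x' - (X s p.1 p.2, p.2)) ∘ fun i => (X s (q i).1 (q i).2, (q i).2))
      =O[l] n := by
    refine Asymptotics.IsBigO.of_bound (2 * flowConst c L s + 2) (Eventually.of_forall fun i => ?_)
    have h3 := h.abs_sub_le (T := s) ⟨hs, le_rfl⟩ (q i).1 (q i).2 p.1 p.2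
    have hC := flowConst_nonneg h.c_pos h.L_nonneg s
    have h5 := hn i
    have a1 := abs_nonneg ((q i).1 - p.1)
    have a2 := abs_nonneg ((q i).2 - p.2)
    have hn0 : 0 ≤ n i := by linarith
    simp only [Function.comp, Prod.mk_sub_mk, Prod.norm_def, Real.norm_eq_abs, abs_of_nonneg hn0]
    apply max_le
    · nlinarith
    · nlinarith [mul_nonneg hC hn0]
  refine (h1.trans_isBigO h2).tendsto_div_nhds_zero.congr fun i => ?_
  simp only [Function.comp]
  congr 1
  have hlin : ∀ a b : ℝ, fderiv ℝ (V s) (X s p.1 p.2, p.2) (a, b)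
      = coefX V X p s * a + coefW V X p s * b := by
    intro a b
    have : ((a, b) : ℝ × ℝ) = a • ((1:ℝ), (0:ℝ)) + b • ((0:ℝ), (1:ℝ)) := by simp
    rw [this, map_add, map_smul, map_smul]
    simp only [coefX, coefW, smul_eq_mul]; ring
  rw [Prod.mk_sub_mk, hlin]; ring

/-- The difference of two trajectories with the same frequency. -/
lemma le_sub_of_pos (h : LipFlow V X c L) (x ω : ℝ) {n : ℝ} (hn : 0 < n) {t : ℝ} (ht : 0 ≤ t) :
    n * exp (-c * t) ≤ X t (x + n) ω - X t x ω := by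
  have := le_of_abs_deriv_le (u := fun s => X s (x + n) ω - X s x ω) (T := t) (c := c)
    (fun s hs => (h.ode (x + n) ω s hs.1).sub (h.ode x ω s hs.1))
    (fun s hs => by simpa using h.lip s hs.1 (X s (x + n) ω, ω) (X s x ω, ω))
    (by simpa [h.init] using hn) (t := t) ⟨ht, le_rfl⟩
  simpa [h.init] using this

/-- Logarithmic derivatives of differences of trajectories. -/
lemma hasDerivAt_log_sub (h : LipFlow V X c L) (x ω : ℝ) {n : ℝ} (hn : 0 < n) {t : ℝ} (ht : 0 ≤ t) :
    HasDerivAt (fun s => log (X s (x + n) ω - X s x ω))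
      ((V t (X t (x + n) ω, ω) - V t (X t x ω, ω)) / (X t (x + n) ω - X t x ω)) t := by
  have hpos := (mul_pos hn (exp_pos (-c * t))).trans_le (h.le_sub_of_pos x ω hn ht)
  exact ((h.ode (x + n) ω t ht).sub (h.ode x ω t ht)).log hpos.ne'

end LipFlow

lemma aestronglyMeasurable_of_hasDerivAt {f f' : ℝ → ℝ} {T : ℝ} (hT : 0 ≤ T)
    (hf : ∀ t, 0 ≤ t → HasDerivAt f (f' t) t) :
    AEStronglyMeasurable f' (volume.restrict (uIoc 0 T)) := by
  refine (measurable_deriv f).aestronglyMeasurable.congr ?_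
  rw [uIoc_of_le hT]
  filter_upwards [ae_restrict_mem measurableSet_Ioc] with t ht
  exact (hf t ht.1.le).deriv

lemma tendsto_zero_of_div {ι : Type*} {l : Filter ι} {f g : ι → ℝ} {m : ℝ} (hm : 0 < m)
    (hf : Tendsto f l (nhds 0)) (hg : ∀ᶠ i in l, m ≤ g i) :
    Tendsto (fun i => f i / g i) l (nhds 0) := by
  refine squeeze_zero_norm' (a := fun i => |f i| / m) ?_ ?_
  · filter_upwards [hg] with i hi
    rw [norm_div, Real.norm_eq_abs, Real.norm_eq_abs]
    exact div_le_div_of_nonneg_left (abs_nonneg _) hm (hi.trans (le_abs_self _))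
  · simpa using hf.abs.div_const m

namespace LipFlow

variable {V : ℝ → ℝ × ℝ → ℝ} {X : ℝ → ℝ → ℝ → ℝ} {c L : ℝ}

lemma tendsto_logDeriv (h : LipFlow V X c L)
    (hV : ∀ t, 0 ≤ t → ContDiff ℝ 1 (V t)) (p : ℝ × ℝ) {s : ℝ}
    (hs : 0 ≤ s) :
    Tendsto (fun n => (V s (X s (p.1 + n) p.2, p.2) - V s (X s p.1 p.2, p.2)) /
      (X s (p.1 + n) p.2 - X s p.1 p.2)) (nhdsWithin 0 (Ioi 0)) (nhds (coefX V X p s)) := by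
  have hq : Tendsto (fun n : ℝ => (p.1 + n, p.2)) (nhdsWithin 0 (Ioi 0)) (nhds p) := by
    have : Continuous fun n : ℝ => (p.1 + n, p.2) := by fun_prop
    simpa using (this.tendsto 0).mono_left nhdsWithin_le_nhds
  have h1 := h.tendsto_linearization hV p hs hq (n := fun n => |n|) (by
    intro n; simp; linarith [abs_nonneg n])
  have h2 := tendsto_zero_of_div (g := fun n => (X s (p.1 + n) p.2 - X s p.1 p.2) / n)
    (exp_pos (-c * s)) h1 (by
      filter_upwards [self_mem_nhdsWithin] with n hn
      rw [le_div_iff₀ hn, mul_comm]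
      exact h.le_sub_of_pos p.1 p.2 hn hs)
  rw [← zero_add (coefX V X p s)]
  refine (h2.add_const (coefX V X p s)).congr' ?_
  filter_upwards [self_mem_nhdsWithin] with n hn
  have hn' : (0:ℝ) < n := hn
  have hpos := (mul_pos hn' (exp_pos (-c * s))).trans_le (h.le_sub_of_pos p.1 p.2 hn' hs)
  rw [abs_of_pos hn']
  field_simp
  ring

lemma aestronglyMeasurable_logDeriv (h : LipFlow V X c L)
    (p : ℝ × ℝ) {n : ℝ} (hn : 0 < n) {T : ℝ} (hT : 0 ≤ T) :
    AEStronglyMeasurable (fun s => (V s (X s (p.1 + n) p.2, p.2) - V s (X s p.1 p.2, p.2)) /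
      (X s (p.1 + n) p.2 - X s p.1 p.2)) (volume.restrict (uIoc 0 T)) :=
  aestronglyMeasurable_of_hasDerivAt hT fun _ ht => h.hasDerivAt_log_sub p.1 p.2 hn ht

lemma abs_logDeriv_le (h : LipFlow V X c L) (p : ℝ × ℝ) {n : ℝ} (hn : 0 < n) {s : ℝ} (hs : 0 ≤ s) :
    |(V s (X s (p.1 + n) p.2, p.2) - V s (X s p.1 p.2, p.2)) /
      (X s (p.1 + n) p.2 - X s p.1 p.2)| ≤ c := by
  have hpos := (mul_pos hn (exp_pos (-c * s))).trans_le (h.le_sub_of_pos p.1 p.2 hn hs)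
  rw [abs_div, div_le_iff₀ (abs_pos.2 hpos.ne')]
  simpa using h.lip s hs (X s (p.1 + n) p.2, p.2) (X s p.1 p.2, p.2)

lemma aestronglyMeasurable_coefX (h : LipFlow V X c L)
    (hV : ∀ t, 0 ≤ t → ContDiff ℝ 1 (V t)) (p : ℝ × ℝ) {T : ℝ}
    (hT : 0 ≤ T) : AEStronglyMeasurable (coefX V X p) (volume.restrict (uIoc 0 T)) := by
  have hseq : Tendsto (fun k : ℕ => 1 / ((k:ℝ) + 1)) atTop (nhdsWithin 0 (Ioi 0)) :=
    tendsto_nhdsWithin_iff.2 ⟨tendsto_one_div_add_atTop_nhds_zero_nat,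
      Eventually.of_forall fun k => by simp only [mem_Ioi]; positivity⟩
  refine aestronglyMeasurable_of_tendsto_ae atTop
    (fun k : ℕ => h.aestronglyMeasurable_logDeriv p (n := 1 / ((k:ℝ) + 1)) (by positivity) hT) ?_
  rw [uIoc_of_le hT]
  filter_upwards [ae_restrict_mem measurableSet_Ioc] with s hs
  exact (h.tendsto_logDeriv hV p hs.1.le).comp hseq

lemma tendsto_sub_div (h : LipFlow V X c L)
    (hV : ∀ t, 0 ≤ t → ContDiff ℝ 1 (V t)) (p : ℝ × ℝ) {t : ℝ}
    (ht : 0 ≤ t) :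
    Tendsto (fun n => (X t (p.1 + n) p.2 - X t p.1 p.2) / n) (nhdsWithin 0 (Ioi 0))
      (nhds (jacX V X p t)) := by
  have h1 : Tendsto (fun n => ∫ s in (0:ℝ)..t,
      (V s (X s (p.1 + n) p.2, p.2) - V s (X s p.1 p.2, p.2)) /
      (X s (p.1 + n) p.2 - X s p.1 p.2)) (nhdsWithin 0 (Ioi 0))
      (nhds (∫ s in (0:ℝ)..t, coefX V X p s)) := by
    refine intervalIntegral.tendsto_integral_filter_of_dominated_convergence (fun _ => c)
      ?_ ?_ intervalIntegrable_const ?_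
    · filter_upwards [self_mem_nhdsWithin] with n hn
      exact h.aestronglyMeasurable_logDeriv p hn ht
    · filter_upwards [self_mem_nhdsWithin] with n hn
      refine Eventually.of_forall fun s hs => ?_
      rw [uIoc_of_le ht] at hs
      exact h.abs_logDeriv_le p hn hs.1.le
    · refine Eventually.of_forall fun s hs => ?_
      rw [uIoc_of_le ht] at hs
      exact h.tendsto_logDeriv hV p hs.1.le
  refine ((continuous_exp.tendsto _).comp h1).congr' ?_
  filter_upwards [self_mem_nhdsWithin] with n hn
  have hn' : (0:ℝ) < n := hn
  have hint : IntervalIntegrable (fun s =>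
      (V s (X s (p.1 + n) p.2, p.2) - V s (X s p.1 p.2, p.2)) /
      (X s (p.1 + n) p.2 - X s p.1 p.2)) volume 0 t := by
    refine (intervalIntegrable_const (c := c)).mono_fun
      (h.aestronglyMeasurable_logDeriv p hn ht) ?_
    rw [uIoc_of_le ht]
    filter_upwards [ae_restrict_mem measurableSet_Ioc] with s hs
    rw [Real.norm_eq_abs, Real.norm_eq_abs, abs_of_pos h.c_pos]
    exact h.abs_logDeriv_le p hn hs.1.le
  have hpos := (mul_pos hn' (exp_pos (-c * t))).trans_le (h.le_sub_of_pos p.1 p.2 hn' ht)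
  simp only [Function.comp]
  rw [intervalIntegral.integral_eq_sub_of_hasDerivAt (fun s hs => by
    rw [uIcc_of_le ht] at hs
    exact h.hasDerivAt_log_sub p.1 p.2 hn' hs.1) hint, exp_sub, exp_log hpos, h.init, h.init]
  simp [exp_log hn']

lemma le_jacX (h : LipFlow V X c L)
    (hV : ∀ t, 0 ≤ t → ContDiff ℝ 1 (V t)) (p : ℝ × ℝ) {t : ℝ} (ht : 0 ≤ t) :
    exp (-c * t) ≤ jacX V X p t := by
  refine ge_of_tendsto (h.tendsto_sub_div hV p ht) ?_
  filter_upwards [self_mem_nhdsWithin] with n hn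
  rw [le_div_iff₀ hn, mul_comm]
  exact h.le_sub_of_pos p.1 p.2 hn ht

lemma continuous_jacX (h : LipFlow V X c L)
    (hV : ∀ t, 0 ≤ t → ContDiff ℝ 1 (V t)) {t : ℝ} (ht : 0 ≤ t) :
    Continuous fun p => jacX V X p t := by
  refine continuous_exp.comp ?_
  refine intervalIntegral.continuous_of_dominated_interval (bound := fun _ => c)
    (fun p => h.aestronglyMeasurable_coefX hV p ht)
    (fun p => Eventually.of_forall fun s hs => ?_) intervalIntegrable_const
    (Eventually.of_forall fun s hs => ?_)
  · rw [uIoc_of_le ht] at hs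
    exact h.abs_coefX_le hV p hs.1.le
  · rw [uIoc_of_le ht] at hs
    exact h.continuous_coefX hV hs.1.le

end LipFlow

lemma abs_fst_add_abs_snd_le (q p : ℝ × ℝ) : |q.1 - p.1| + |q.2 - p.2| ≤ 2 * ‖q - p‖ := by
  have h1 := norm_fst_le (q - p)
  have h2 := norm_snd_le (q - p)
  simp only [Prod.fst_sub, Prod.snd_sub, Real.norm_eq_abs] at h1 h2
  linarith

namespace LipFlow

/-- The derivative of the quotient of the displacement of the trajectory started at `q` by the
displacement of the trajectory started at `(p.1 + ‖q - p‖, p.2)`. -/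
def quotDeriv (V : ℝ → ℝ × ℝ → ℝ) (X : ℝ → ℝ → ℝ → ℝ) (p q : ℝ × ℝ) (s : ℝ) : ℝ :=
  ((V s (X s q.1 q.2, q.2) - V s (X s p.1 p.2, p.2)) *
      (X s (p.1 + ‖q - p‖) p.2 - X s p.1 p.2) -
    (X s q.1 q.2 - X s p.1 p.2) *
      (V s (X s (p.1 + ‖q - p‖) p.2, p.2) - V s (X s p.1 p.2, p.2))) /
    (X s (p.1 + ‖q - p‖) p.2 - X s p.1 p.2) ^ 2

/-- The `ω`-derivative of the flow. -/
def jacW (V : ℝ → ℝ × ℝ → ℝ) (X : ℝ → ℝ → ℝ → ℝ) (p : ℝ × ℝ) (t : ℝ) : ℝ :=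
  jacX V X p t * ∫ s in (0:ℝ)..t, coefW V X p s / jacX V X p s

variable {V : ℝ → ℝ × ℝ → ℝ} {X : ℝ → ℝ → ℝ → ℝ} {c L : ℝ}

lemma hasDerivAt_quot (h : LipFlow V X c L) {p q : ℝ × ℝ} (hqp : q ≠ p) {s : ℝ} (hs : 0 ≤ s) :
    HasDerivAt (fun s => (X s q.1 q.2 - X s p.1 p.2) /
      (X s (p.1 + ‖q - p‖) p.2 - X s p.1 p.2)) (quotDeriv V X p q s) s := by
  have hn : 0 < ‖q - p‖ := norm_pos_iff.2 (sub_ne_zero.2 hqp)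
  have hpos := (mul_pos hn (exp_pos (-c * s))).trans_le (h.le_sub_of_pos p.1 p.2 hn hs)
  exact ((h.ode q.1 q.2 s hs).sub (h.ode p.1 p.2 s hs)).div
    ((h.ode (p.1 + ‖q - p‖) p.2 s hs).sub (h.ode p.1 p.2 s hs)) hpos.ne'

lemma abs_quotDeriv_le (h : LipFlow V X c L)
    {p q : ℝ × ℝ} (hqp : q ≠ p) {s T : ℝ} (hs : s ∈ Icc 0 T) :
    |quotDeriv V X p q s| ≤ (4 * c * flowConst c L T + L) / exp (-c * T) := by
  have hn : 0 < ‖q - p‖ := norm_pos_iff.2 (sub_ne_zero.2 hqp)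
  have hu := h.le_sub_of_pos p.1 p.2 hn hs.1
  have hpos := (mul_pos hn (exp_pos (-c * s))).trans_le hu
  have hΔ := h.abs_sub_le hs q.1 q.2 p.1 p.2
  have hqn := abs_fst_add_abs_snd_le q p
  have hk := norm_snd_le (q - p)
  have hv := h.lip s hs.1 (X s q.1 q.2, q.2) (X s p.1 p.2, p.2)
  have hv' := h.lip s hs.1 (X s (p.1 + ‖q - p‖) p.2, p.2) (X s p.1 p.2, p.2)
  have hC := flowConst_nonneg h.c_pos h.L_nonneg T
  have hc := h.c_pos
  have hL := h.L_nonneg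
  simp only [sub_self, abs_zero, mul_zero, add_zero, Prod.snd_sub, Real.norm_eq_abs] at hv hv' hk
  unfold quotDeriv
  set n := ‖q - p‖
  set u := X s (p.1 + n) p.2 - X s p.1 p.2
  set Δ := X s q.1 q.2 - X s p.1 p.2
  set v := V s (X s q.1 q.2, q.2) - V s (X s p.1 p.2, p.2)
  set v' := V s (X s (p.1 + n) p.2, p.2) - V s (X s p.1 p.2, p.2)
  have he : exp (-c * T) ≤ exp (-c * s) := by
    apply exp_le_exp.2; nlinarith [hs.2]
  have hu' : n * exp (-c * T) ≤ u := (by gcongr : n * exp (-c * T) ≤ n * exp (-c * s)).trans hu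
  have hΔ' : |Δ| ≤ 2 * flowConst c L T * n := by
    calc |Δ| ≤ _ := hΔ
      _ ≤ flowConst c L T * (2 * n) := by gcongr
      _ = _ := by ring
  rw [abs_of_pos hpos] at hv'
  have hnum : |v * u - Δ * v'| ≤ (2 * c * |Δ| + L * n) * u := by
    calc |v * u - Δ * v'| ≤ |v * u| + |Δ * v'| := abs_sub _ _
      _ = |v| * u + |Δ| * |v'| := by rw [abs_mul, abs_mul, abs_of_pos hpos]
      _ ≤ (c * |Δ| + L * n) * u + |Δ| * (c * u) := by
        have : |v| ≤ c * |Δ| + L * n := hv.trans (by gcongr)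
        gcongr
      _ = _ := by ring
  rw [abs_div, abs_of_pos (pow_pos hpos 2), div_le_div_iff₀ (pow_pos hpos 2) (exp_pos _)]
  calc |v * u - Δ * v'| * exp (-c * T)
      ≤ ((2 * c * (2 * flowConst c L T * n) + L * n) * u) * exp (-c * T) := by
        gcongr
        exact hnum.trans (by gcongr)
    _ = (4 * c * flowConst c L T + L) * u * (n * exp (-c * T)) := by ring
    _ ≤ (4 * c * flowConst c L T + L) * u * u := by gcongr
    _ = _ := by ring

lemma tendsto_quotDeriv (h : LipFlow V X c L)
    (hV : ∀ t, 0 ≤ t → ContDiff ℝ 1 (V t)) (p : ℝ × ℝ) {s : ℝ}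
    (hs : 0 ≤ s) :
    Tendsto (fun q => quotDeriv V X p q s -
      (q.2 - p.2) / ‖q - p‖ * (coefW V X p s / jacX V X p s))
      (nhdsWithin p {p}ᶜ) (nhds 0) := by
  have hn : Tendsto (fun q => ‖q - p‖) (nhdsWithin p {p}ᶜ) (nhdsWithin 0 (Ioi 0)) := by
    refine tendsto_nhdsWithin_iff.2 ⟨?_, ?_⟩
    · have : Continuous fun q : ℝ × ℝ => ‖q - p‖ := by fun_prop
      simpa using (this.tendsto p).mono_left nhdsWithin_le_nhds
    · filter_upwards [self_mem_nhdsWithin] with q hq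
      exact norm_pos_iff.2 (sub_ne_zero.2 hq)
  have hu := (h.tendsto_sub_div hV p hs).comp hn
  have hJ : 0 < jacX V X p s := exp_pos _
  have hlow : ∀ᶠ q in nhdsWithin p {p}ᶜ,
      exp (-c * s) ≤ (X s (p.1 + ‖q - p‖) p.2 - X s p.1 p.2) / ‖q - p‖ := by
    filter_upwards [self_mem_nhdsWithin] with q hq
    have hq' : 0 < ‖q - p‖ := norm_pos_iff.2 (sub_ne_zero.2 hq)
    rw [le_div_iff₀ hq', mul_comm]
    exact h.le_sub_of_pos p.1 p.2 hq' hs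
  have e1 := h.tendsto_linearization hV p hs (q := fun q => q) (n := fun q => ‖q - p‖)
    (l := nhdsWithin p {p}ᶜ) nhdsWithin_le_nhds (fun q => abs_fst_add_abs_snd_le q p)
  have hq2 : Tendsto (fun q : ℝ × ℝ => (p.1 + ‖q - p‖, p.2)) (nhdsWithin p {p}ᶜ) (nhds p) := by
    have : Continuous fun q : ℝ × ℝ => (p.1 + ‖q - p‖, p.2) := by fun_prop
    simpa using (this.tendsto p).mono_left nhdsWithin_le_nhds
  have e2 := h.tendsto_linearization hV p hs (n := fun q : ℝ × ℝ => ‖q - p‖) hq2 (fun q => by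
    simp; linarith [norm_nonneg (q - p)])
  have f1 := tendsto_zero_of_div (exp_pos (-c * s)) e1 hlow
  have hΔ : IsBoundedUnder (· ≤ ·) (nhdsWithin p {p}ᶜ)
      (fun q => ‖(X s q.1 q.2 - X s p.1 p.2) / ‖q - p‖‖) := by
    refine ⟨2 * flowConst c L s, ?_⟩
    rw [eventually_map]
    filter_upwards [self_mem_nhdsWithin] with q hq
    have hq' : 0 < ‖q - p‖ := norm_pos_iff.2 (sub_ne_zero.2 hq)
    rw [norm_div, norm_norm, div_le_iff₀ hq', Real.norm_eq_abs]
    have := h.abs_sub_le (T := s) ⟨hs, le_rfl⟩ q.1 q.2 p.1 p.2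
    have := mul_le_mul_of_nonneg_left (abs_fst_add_abs_snd_le q p)
      (flowConst_nonneg h.c_pos h.L_nonneg s)
    linarith
  have f2 := tendsto_zero_of_div (exp_pos (-c * s))
    (tendsto_zero_of_div (exp_pos (-c * s)) (e2.zero_mul_isBoundedUnder_le hΔ) hlow) hlow
  have f3 : Tendsto (fun q => (((X s (p.1 + ‖q - p‖) p.2 - X s p.1 p.2) / ‖q - p‖)⁻¹
      - (jacX V X p s)⁻¹) * (coefW V X p s * ((q.2 - p.2) / ‖q - p‖)))
      (nhdsWithin p {p}ᶜ) (nhds 0) := by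
    have g1 : Tendsto (fun q => ((X s (p.1 + ‖q - p‖) p.2 - X s p.1 p.2) / ‖q - p‖)⁻¹
      - (jacX V X p s)⁻¹) (nhdsWithin p {p}ᶜ) (nhds 0) := by
      simpa using (hu.inv₀ hJ.ne').sub_const (jacX V X p s)⁻¹
    refine g1.zero_mul_isBoundedUnder_le ⟨|coefW V X p s|, ?_⟩
    rw [eventually_map]
    filter_upwards [self_mem_nhdsWithin] with q hq
    have hq' : 0 < ‖q - p‖ := norm_pos_iff.2 (sub_ne_zero.2 hq)
    have := norm_snd_le (q - p)
    simp only [Function.comp, norm_mul, norm_div, Real.norm_eq_abs]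
    refine mul_le_of_le_one_right (abs_nonneg _) ?_
    rw [abs_of_pos hq', div_le_one hq']
    simpa using this
  have := (f1.sub f2).add f3
  simp only [sub_zero, add_zero] at this
  refine this.congr' ?_
  filter_upwards [self_mem_nhdsWithin] with q hq
  have hq' : 0 < ‖q - p‖ := norm_pos_iff.2 (sub_ne_zero.2 hq)
  have hpos := (mul_pos hq' (exp_pos (-c * s))).trans_le (h.le_sub_of_pos p.1 p.2 hq' hs)
  unfold quotDeriv
  field_simp
  ring

lemma aestronglyMeasurable_coefW_div (h : LipFlow V X c L)
    (hV : ∀ t, 0 ≤ t → ContDiff ℝ 1 (V t)) (p : ℝ × ℝ)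
    {T : ℝ} (hT : 0 ≤ T) :
    AEStronglyMeasurable (fun s => coefW V X p s / jacX V X p s)
      (volume.restrict (uIoc 0 T)) := by
  have hq : Tendsto (fun k : ℕ => (p.1, p.2 + 1 / ((k:ℝ) + 1))) atTop (nhdsWithin p {p}ᶜ) := by
    refine tendsto_nhdsWithin_iff.2 ⟨?_, Eventually.of_forall fun k => ?_⟩
    · simpa using (tendsto_const_nhds (x := p.1)).prodMk_nhds
        ((tendsto_one_div_add_atTop_nhds_zero_nat (𝕜 := ℝ)).const_add p.2)
    · have : (0:ℝ) < 1 / ((k:ℝ) + 1) := by positivity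
      intro heq
      have := congrArg Prod.snd (mem_singleton_iff.1 heq)
      simp only at this
      linarith
  refine aestronglyMeasurable_of_tendsto_ae atTop
    (f := fun k : ℕ => quotDeriv V X p (p.1, p.2 + 1 / ((k:ℝ) + 1))) (fun k => ?_) ?_
  · refine aestronglyMeasurable_of_hasDerivAt hT fun t ht => h.hasDerivAt_quot ?_ ht
    have : (0:ℝ) < 1 / ((k:ℝ) + 1) := by positivity
    intro heq
    have := congrArg Prod.snd heq
    simp only at this
    linarith
  · rw [uIoc_of_le hT]
    filter_upwards [ae_restrict_mem measurableSet_Ioc] with s hs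
    have := ((h.tendsto_quotDeriv hV p hs.1.le).comp hq).add_const
      (coefW V X p s / jacX V X p s)
    rw [zero_add] at this
    refine this.congr fun k => ?_
    have hk : (0:ℝ) < 1 / ((k:ℝ) + 1) := by positivity
    have hnorm : ‖((p.1, p.2 + 1 / ((k:ℝ) + 1)) : ℝ × ℝ) - p‖ = 1 / ((k:ℝ) + 1) := by
      rw [Prod.norm_def]
      simp only [Prod.fst_sub, Prod.snd_sub, sub_self, norm_zero, add_sub_cancel_left,
        Real.norm_eq_abs, abs_of_pos hk]
      exact max_eq_right hk.le
    simp only [Function.comp, hnorm, add_sub_cancel_left, div_self hk.ne', one_mul]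
    ring

lemma abs_coefW_div_le (h : LipFlow V X c L)
    (hV : ∀ t, 0 ≤ t → ContDiff ℝ 1 (V t)) (p : ℝ × ℝ) {s T : ℝ}
    (hs : s ∈ Icc 0 T) : |coefW V X p s / jacX V X p s| ≤ L / exp (-c * T) := by
  have hJ : 0 < jacX V X p s := exp_pos _
  have he : exp (-c * T) ≤ exp (-c * s) := by
    apply exp_le_exp.2; nlinarith [hs.2, h.c_pos]
  rw [abs_div, abs_of_pos hJ]
  exact div_le_div₀ h.L_nonneg (h.abs_coefW_le hV p hs.1) (exp_pos _)
    (he.trans (h.le_jacX hV p hs.1))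

lemma intervalIntegrable_coefW_div (h : LipFlow V X c L)
    (hV : ∀ t, 0 ≤ t → ContDiff ℝ 1 (V t)) (p : ℝ × ℝ)
    {T : ℝ} (hT : 0 ≤ T) :
    IntervalIntegrable (fun s => coefW V X p s / jacX V X p s) volume 0 T := by
  refine (intervalIntegrable_const (c := L / exp (-c * T))).mono_fun
    (h.aestronglyMeasurable_coefW_div hV p hT) ?_
  rw [uIoc_of_le hT]
  filter_upwards [ae_restrict_mem measurableSet_Ioc] with s hs
  rw [Real.norm_eq_abs, Real.norm_eq_abs]
  exact (h.abs_coefW_div_le hV p ⟨hs.1.le, hs.2⟩).trans (le_abs_self _)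

lemma continuous_jacW (h : LipFlow V X c L)
    (hV : ∀ t, 0 ≤ t → ContDiff ℝ 1 (V t)) {t : ℝ} (ht : 0 ≤ t) :
    Continuous fun p => jacW V X p t := by
  refine (h.continuous_jacX hV ht).mul ?_
  refine intervalIntegral.continuous_of_dominated_interval
    (bound := fun _ => L / exp (-c * t))
    (fun p => h.aestronglyMeasurable_coefW_div hV p ht)
    (fun p => Eventually.of_forall fun s hs => ?_) intervalIntegrable_const
    (Eventually.of_forall fun s hs => ?_)
  · rw [uIoc_of_le ht] at hs
    exact h.abs_coefW_div_le hV p ⟨hs.1.le, hs.2⟩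
  · rw [uIoc_of_le ht] at hs
    exact (h.continuous_coefW hV hs.1.le).div (h.continuous_jacX hV hs.1.le)
      fun p => (exp_pos _).ne'

lemma tendsto_quot (h : LipFlow V X c L)
    (hV : ∀ t, 0 ≤ t → ContDiff ℝ 1 (V t)) (p : ℝ × ℝ) {t : ℝ} (ht : 0 ≤ t) :
    Tendsto (fun q : ℝ × ℝ => (X t q.1 q.2 - X t p.1 p.2) /
      (X t (p.1 + ‖q - p‖) p.2 - X t p.1 p.2) - (q.1 - p.1) / ‖q - p‖ -
      (q.2 - p.2) / ‖q - p‖ * ∫ s in (0:ℝ)..t, coefW V X p s / jacX V X p s)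
      (nhdsWithin p {p}ᶜ) (nhds 0) := by
  set B := (4 * c * flowConst c L t + L) / exp (-c * t)
  have hmeas : ∀ q, q ≠ p →
      AEStronglyMeasurable (quotDeriv V X p q) (volume.restrict (uIoc 0 t)) := fun q hq =>
    aestronglyMeasurable_of_hasDerivAt ht fun s hs => h.hasDerivAt_quot hq hs
  have hint : ∀ q, q ≠ p → IntervalIntegrable (quotDeriv V X p q) volume 0 t := fun q hq => by
    refine (intervalIntegrable_const (c := B)).mono_fun (hmeas q hq) ?_
    rw [uIoc_of_le ht]
    filter_upwards [ae_restrict_mem measurableSet_Ioc] with s hs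
    rw [Real.norm_eq_abs, Real.norm_eq_abs]
    exact (h.abs_quotDeriv_le hq ⟨hs.1.le, hs.2⟩).trans (le_abs_self _)
  have h1 : Tendsto (fun q => ∫ s in (0:ℝ)..t, (quotDeriv V X p q s -
      (q.2 - p.2) / ‖q - p‖ * (coefW V X p s / jacX V X p s)))
      (nhdsWithin p {p}ᶜ) (nhds (∫ s in (0:ℝ)..t, (0:ℝ))) := by
    refine intervalIntegral.tendsto_integral_filter_of_dominated_convergence
      (fun _ => B + L / exp (-c * t)) ?_ ?_ intervalIntegrable_const ?_
    · filter_upwards [self_mem_nhdsWithin] with q hq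
      exact (hmeas q hq).sub ((h.aestronglyMeasurable_coefW_div hV p ht).const_mul _)
    · filter_upwards [self_mem_nhdsWithin] with q hq
      have hq' : 0 < ‖q - p‖ := norm_pos_iff.2 (sub_ne_zero.2 hq)
      refine Eventually.of_forall fun s hs => ?_
      rw [uIoc_of_le ht] at hs
      refine (norm_sub_le _ _).trans (add_le_add
        (h.abs_quotDeriv_le hq ⟨hs.1.le, hs.2⟩) ?_)
      rw [norm_mul]
      refine (mul_le_of_le_one_left (norm_nonneg _) ?_).trans
        (h.abs_coefW_div_le hV p ⟨hs.1.le, hs.2⟩)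
      rw [norm_div, norm_norm, div_le_one hq']
      exact norm_snd_le (q - p)
    · refine Eventually.of_forall fun s hs => ?_
      rw [uIoc_of_le ht] at hs
      exact h.tendsto_quotDeriv hV p hs.1.le
  rw [intervalIntegral.integral_zero] at h1
  refine h1.congr' ?_
  filter_upwards [self_mem_nhdsWithin] with q hq
  rw [intervalIntegral.integral_sub (hint q hq)
    ((h.intervalIntegrable_coefW_div hV p ht).const_mul _),
    intervalIntegral.integral_const_mul,
    intervalIntegral.integral_eq_sub_of_hasDerivAt (fun s hs => by
      rw [uIcc_of_le ht] at hs
      exact h.hasDerivAt_quot hq hs.1) (hint q hq)]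
  simp only [h.init, add_sub_cancel_left]

lemma hasFDerivAt (h : LipFlow V X c L)
    (hV : ∀ t, 0 ≤ t → ContDiff ℝ 1 (V t)) (p : ℝ × ℝ) {t : ℝ} (ht : 0 ≤ t) :
    HasFDerivAt (fun q : ℝ × ℝ => X t q.1 q.2)
      (jacX V X p t • ContinuousLinearMap.fst ℝ ℝ ℝ +
        jacW V X p t • ContinuousLinearMap.snd ℝ ℝ ℝ) p := by
  have hn : Tendsto (fun q => ‖q - p‖) (nhdsWithin p {p}ᶜ) (nhdsWithin 0 (Ioi 0)) := by
    refine tendsto_nhdsWithin_iff.2 ⟨?_, ?_⟩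
    · have : Continuous fun q : ℝ × ℝ => ‖q - p‖ := by fun_prop
      simpa using (this.tendsto p).mono_left nhdsWithin_le_nhds
    · filter_upwards [self_mem_nhdsWithin] with q hq
      exact norm_pos_iff.2 (sub_ne_zero.2 hq)
  have hu := (h.tendsto_sub_div hV p ht).comp hn
  set Q := ∫ s in (0:ℝ)..t, coefW V X p s / jacX V X p s with hQ
  have h1 := (h.tendsto_quot hV p ht).mul hu
  rw [zero_mul] at h1
  have h2 : Tendsto (fun q => ((X t (p.1 + ‖q - p‖) p.2 - X t p.1 p.2) / ‖q - p‖ -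
      jacX V X p t) * ((q.1 - p.1) / ‖q - p‖ + (q.2 - p.2) / ‖q - p‖ * Q))
      (nhdsWithin p {p}ᶜ) (nhds 0) := by
    have g1 : Tendsto (fun q => (X t (p.1 + ‖q - p‖) p.2 - X t p.1 p.2) / ‖q - p‖ -
      jacX V X p t) (nhdsWithin p {p}ᶜ) (nhds 0) := by
      simpa using hu.sub_const (jacX V X p t)
    refine g1.zero_mul_isBoundedUnder_le ⟨1 + |Q|, ?_⟩
    rw [eventually_map]
    filter_upwards [self_mem_nhdsWithin] with q hq
    have hq' : 0 < ‖q - p‖ := norm_pos_iff.2 (sub_ne_zero.2 hq)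
    refine (norm_add_le _ _).trans (add_le_add ?_ ?_)
    · rw [norm_div, norm_norm, div_le_one hq']
      exact norm_fst_le (q - p)
    · rw [norm_mul]
      refine mul_le_of_le_one_left (norm_nonneg _) ?_
      rw [norm_div, norm_norm, div_le_one hq']
      exact norm_snd_le (q - p)
  have h3 := (h1.add h2).norm
  rw [add_zero, norm_zero] at h3
  rw [hasFDerivAt_iff_tendsto]
  have h4 : Tendsto (fun q : ℝ × ℝ => ‖q - p‖⁻¹ * ‖X t q.1 q.2 - X t p.1 p.2 -
      (jacX V X p t • ContinuousLinearMap.fst ℝ ℝ ℝ +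
        jacW V X p t • ContinuousLinearMap.snd ℝ ℝ ℝ) (q - p)‖)
      (nhdsWithin p {p}ᶜ) (nhds 0) := by
    refine h3.congr' ?_
    filter_upwards [self_mem_nhdsWithin] with q hq
    have hq' : 0 < ‖q - p‖ := norm_pos_iff.2 (sub_ne_zero.2 hq)
    have hpos := (mul_pos hq' (exp_pos (-c * t))).trans_le (h.le_sub_of_pos p.1 p.2 hq' ht)
    rw [← norm_norm (q - p), ← norm_inv, ← norm_mul]
    congr 1
    simp only [Function.comp, jacW, ← hQ, norm_norm, add_apply,
      smul_apply, ContinuousLinearMap.coe_fst',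
      ContinuousLinearMap.coe_snd', smul_eq_mul, Prod.fst_sub, Prod.snd_sub]
    field_simp
    ring
  have h5 := continuousAt_iff_punctured_nhds (a := p) (f := fun q : ℝ × ℝ =>
    ‖q - p‖⁻¹ * ‖X t q.1 q.2 - X t p.1 p.2 - (jacX V X p t • ContinuousLinearMap.fst ℝ ℝ ℝ +
      jacW V X p t • ContinuousLinearMap.snd ℝ ℝ ℝ) (q - p)‖)
  have h6 := h5.2 (by simpa using h4)
  simpa [ContinuousAt] using h6

/-- A flow of a field that is `C¹` in space is `C¹` in space. -/
lemma contDiff (h : LipFlow V X c L) (hV : ∀ t, 0 ≤ t → ContDiff ℝ 1 (V t)) {t : ℝ} (ht : 0 ≤ t) :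
    ContDiff ℝ 1 fun q : ℝ × ℝ => X t q.1 q.2 := by
  rw [contDiff_one_iff_hasFDerivAt]
  refine ⟨_, ?_, fun p => h.hasFDerivAt hV p ht⟩
  exact ((h.continuous_jacX hV ht).smul continuous_const).add
    ((h.continuous_jacW hV ht).smul continuous_const)

end LipFlow

/-- A compactly supported `C¹` bump function whose derivative is controlled by its defect
from `1`. -/
def quarticBump (y : ℝ) : ℝ := max 0 (1 - y ^ 2) ^ 2

/-- The derivative of `quarticBump`. -/
def quarticBumpDeriv (y : ℝ) : ℝ := -4 * y * max 0 (1 - y ^ 2)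

lemma hasDerivAt_sq_max_zero (u : ℝ) : HasDerivAt (fun u : ℝ => max 0 u ^ 2) (2 * max 0 u) u := by
  rcases lt_trichotomy u 0 with hu | rfl | hu
  · rw [max_eq_left hu.le, mul_zero]
    refine (hasDerivAt_const u (0:ℝ)).congr_of_eventuallyEq ?_
    filter_upwards [Iio_mem_nhds hu] with w hw
    have hw0 : w < 0 := hw
    simp [max_eq_left hw0.le]
  · rw [max_self, mul_zero, hasDerivAt_iff_isLittleO_nhds_zero]
    simp only [zero_add, max_self, smul_zero, sub_zero]
    refine Asymptotics.IsBigO.trans_isLittleO (g := fun w : ℝ => w ^ 2) ?_ ?_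
    · refine Asymptotics.IsBigO.of_bound 1 (Eventually.of_forall fun w => ?_)
      rw [norm_sub_rev, one_mul, norm_pow]
      rcases le_total w 0 with hw | hw <;> simp [hw, sq_nonneg]
    · exact Asymptotics.isLittleO_pow_id one_lt_two
  · rw [max_eq_right hu.le]
    refine (by simpa using hasDerivAt_pow 2 u : HasDerivAt (fun w : ℝ => w ^ 2)
      (2 * u) u).congr_of_eventuallyEq ?_
    filter_upwards [Ioi_mem_nhds hu] with w hw
    have hw0 : 0 < w := hw
    simp [max_eq_right hw0.le]

lemma hasDerivAt_quarticBump (y : ℝ) : HasDerivAt quarticBump (quarticBumpDeriv y) y := by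
  have h1 : HasDerivAt (fun y : ℝ => 1 - y ^ 2) (-(2 * y)) y := by
    simpa using (hasDerivAt_pow 2 y).const_sub 1
  refine ((hasDerivAt_sq_max_zero (1 - y ^ 2)).comp y h1).congr_deriv ?_
  unfold quarticBumpDeriv; ring

lemma continuous_quarticBumpDeriv : Continuous quarticBumpDeriv := by
  unfold quarticBumpDeriv; fun_prop

lemma contDiff_quarticBump : ContDiff ℝ 1 quarticBump := by
  rw [contDiff_one_iff_deriv]
  refine ⟨fun y => (hasDerivAt_quarticBump y).differentiableAt, ?_⟩
  rw [show deriv quarticBump = quarticBumpDeriv from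
    funext fun y => (hasDerivAt_quarticBump y).deriv]
  exact continuous_quarticBumpDeriv

lemma continuous_quarticBump : Continuous quarticBump := contDiff_quarticBump.continuous

lemma quarticBump_nonneg (y : ℝ) : 0 ≤ quarticBump y := sq_nonneg _

lemma quarticBump_le_one (y : ℝ) : quarticBump y ≤ 1 := by
  unfold quarticBump
  have h1 : max 0 (1 - y ^ 2) ≤ 1 := max_le zero_le_one (by nlinarith)
  have h0 : (0:ℝ) ≤ max 0 (1 - y ^ 2) := le_max_left _ _
  nlinarith

lemma quarticBump_zero : quarticBump 0 = 1 := by simp [quarticBump]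

lemma quarticBump_of_one_le {y : ℝ} (hy : 1 ≤ |y|) : quarticBump y = 0 := by
  have : 1 ≤ y ^ 2 := by rw [← sq_abs]; nlinarith
  rw [quarticBump, max_eq_left (by linarith)]; simp

lemma eq_zero_of_quarticBump {y : ℝ} (hy : 1 - quarticBump y = 0) : y = 0 := by
  by_contra hne
  have h2 : 0 < y ^ 2 := by positivity
  have h1 : max 0 (1 - y ^ 2) < 1 := max_lt zero_lt_one (by linarith)
  have h0 : (0:ℝ) ≤ max 0 (1 - y ^ 2) := le_max_left _ _
  unfold quarticBump at hy
  nlinarith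

lemma abs_mul_quarticBumpDeriv_le (y : ℝ) :
    |y| * |quarticBumpDeriv y| ≤ 4 * (1 - quarticBump y) := by
  rcases le_total 1 (y ^ 2) with hy | hy
  · rw [quarticBumpDeriv, max_eq_left (by linarith)]
    have := quarticBump_le_one y
    simp; linarith
  · rw [← abs_mul, quarticBumpDeriv, quarticBump, max_eq_right (by linarith)]
    have h2 := sq_nonneg y
    rw [show y * (-4 * y * (1 - y ^ 2)) = -(4 * y ^ 2 * (1 - y ^ 2)) by ring, abs_neg,
      abs_of_nonneg (by apply mul_nonneg <;> linarith)]
    nlinarith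

lemma abs_quarticBumpDeriv_le (y : ℝ) : |quarticBumpDeriv y| ≤ 4 := by
  rcases le_total 1 (y ^ 2) with hy | hy
  · rw [quarticBumpDeriv, max_eq_left (by linarith)]; simp
  · rw [quarticBumpDeriv, max_eq_right (by linarith), abs_mul, abs_mul,
      abs_of_nonneg (by linarith : 0 ≤ 1 - y ^ 2)]
    have h1 : |y| ≤ 1 := abs_le_one_iff_mul_self_le_one.2 (by nlinarith)
    have h0 := abs_nonneg y
    rw [abs_neg, abs_of_pos (by norm_num : (0:ℝ) < 4)]
    nlinarith [sq_nonneg y]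

lemma abs_quarticBump_sub_le (y z : ℝ) : |quarticBump y - quarticBump z| ≤ 4 * |y - z| :=
  Convex.norm_image_sub_le_of_norm_hasDerivWithin_le (s := univ)
    (fun w _ => (hasDerivAt_quarticBump w).hasDerivWithinAt)
    (fun w _ => abs_quarticBumpDeriv_le w) convex_univ (mem_univ z) (mem_univ y)

lemma deriv_fst_eq_fderiv {φ : ℝ × ℝ → ℝ} (hφ : ContDiff ℝ 1 φ) (z : ℝ × ℝ) :
    deriv (fun x => φ (x, z.2)) z.1 = fderiv ℝ φ z (1, 0) := by
  have h1 : HasDerivAt (fun x : ℝ => (x, z.2)) ((1:ℝ), (0:ℝ)) z.1 :=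
    (hasDerivAt_id z.1).prodMk (hasDerivAt_const z.1 z.2)
  have h2 : HasFDerivAt φ (fderiv ℝ φ z) (z.1, z.2) :=
    (hφ.differentiable one_ne_zero z).hasFDerivAt
  exact (h2.comp_hasDerivAt z.1 h1).deriv

lemma continuous_deriv_fst {φ : ℝ × ℝ → ℝ} (hφ : ContDiff ℝ 1 φ) :
    Continuous fun z : ℝ × ℝ => deriv (fun x => φ (x, z.2)) z.1 := by
  simp_rw [deriv_fst_eq_fderiv hφ]
  exact (hφ.continuous_fderiv one_ne_zero).clm_apply continuous_const

lemma hasCompactSupport_deriv_fst {φ : ℝ × ℝ → ℝ} (hφ : ContDiff ℝ 1 φ)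
    (hc : HasCompactSupport φ) :
    HasCompactSupport fun z : ℝ × ℝ => deriv (fun x => φ (x, z.2)) z.1 := by
  simp_rw [deriv_fst_eq_fderiv hφ]
  exact hc.fderiv_apply ℝ (1, 0)

section

variable {F : Measure (ℝ × ℝ) → ℝ × ℝ → ℝ} {μ : ℝ → Measure (ℝ × ℝ)}

/-- The weak equation for test functions whose support is only compact in space. -/
lemma IsSol.weak_eq (hsol : IsSol F μ) {Φ : ℝ → ℝ × ℝ → ℝ}
    (hΦ : ContDiff ℝ 1 (fun q : ℝ × (ℝ × ℝ) => Φ q.1 q.2)) {T : ℝ} (hT : 0 ≤ T)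
    {K : Set (ℝ × ℝ)} (hK : IsCompact K) (hΦK : ∀ t, |t| ≤ T + 2 → ∀ z ∉ K, Φ t z = 0) :
    ∫ z, Φ T z ∂(μ T) = (∫ z, Φ 0 z ∂(μ 0)) +
        ∫ s in (0:ℝ)..T, ∫ z, (deriv (fun u => Φ u z) s +
          F (μ s) z * deriv (fun x => Φ s (x, z.2)) z.1) ∂(μ s) := by
  let θ : ContDiffBump (0:ℝ) := ⟨T + 1, T + 2, by linarith, by linarith⟩
  have hθ1 : ∀ s ∈ Icc 0 T, (θ : ℝ → ℝ) =ᶠ[nhds s] fun _ => 1 := by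
    intro s hs
    filter_upwards [Metric.ball_mem_nhds s one_pos] with u hu
    apply θ.one_of_mem_closedBall
    rw [Metric.mem_ball, Real.dist_eq] at hu
    rw [Metric.mem_closedBall, Real.dist_eq, sub_zero]
    have := abs_lt.1 hu
    show |u| ≤ T + 1
    rw [abs_le]
    constructor <;> linarith [hs.1, hs.2]
  have hθv : ∀ s ∈ Icc 0 T, θ s = 1 := fun s hs => (hθ1 s hs).self_of_nhds
  have key := hsol.2 (fun t z => θ t * Φ t z)
    ((θ.contDiff.comp contDiff_fst).mul hΦ) (by
      refine HasCompactSupport.intro (K := Metric.closedBall (0:ℝ) (T + 2) ×ˢ K)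
        ((isCompact_closedBall _ _).prod hK) ?_
      rintro ⟨t, z⟩ htz
      by_cases ht : |t| ≤ T + 2
      · have hz : z ∉ K := fun hz => htz ⟨by simpa using ht, hz⟩
        simp [hΦK t ht z hz]
      · have : θ t = 0 := θ.zero_of_le_dist (by simpa using (not_le.1 ht).le)
        simp [this]) T hT
  rw [hθv T ⟨hT, le_rfl⟩, hθv 0 ⟨le_rfl, hT⟩] at key
  simp only [one_mul] at key
  rw [key]
  congr 1
  refine intervalIntegral.integral_congr fun s hs => ?_
  rw [uIcc_of_le hT] at hs
  congr 1
  funext z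
  have h1 : deriv (fun u => θ u * Φ u z) s = deriv (fun u => Φ u z) s := by
    refine Filter.EventuallyEq.deriv_eq ?_
    filter_upwards [hθ1 s hs] with u hu
    simp [hu]
  rw [h1, hθv s hs]
  simp only [one_mul]

/-- The time derivative of `t ↦ ∫ φ dμ_t` prescribed by the weak equation. -/
def weakRate (F : Measure (ℝ × ℝ) → ℝ × ℝ → ℝ) (μ : ℝ → Measure (ℝ × ℝ)) (φ : ℝ × ℝ → ℝ)
    (s : ℝ) : ℝ :=
  ∫ z, F (μ s) z * deriv (fun x => φ (x, z.2)) z.1 ∂(μ s)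

lemma integrable_mul_deriv_fst {ρ : Measure (ℝ × ℝ)} [IsProbabilityMeasure ρ] {f : ℝ × ℝ → ℝ}
    (hf : Continuous f) {φ : ℝ × ℝ → ℝ} (hφ : ContDiff ℝ 1 φ) (hc : HasCompactSupport φ) :
    Integrable (fun z => f z * deriv (fun x => φ (x, z.2)) z.1) ρ :=
  (hf.mul (continuous_deriv_fst hφ)).integrable_of_hasCompactSupport
    (hasCompactSupport_deriv_fst hφ hc).mul_left

lemma IsSol.intervalIntegrable_weakRate_of_ne (hsol : IsSol F μ)
    (hprob : ∀ t, 0 ≤ t → IsProbabilityMeasure (μ t)) (hF : ∀ t, 0 ≤ t → Continuous (F (μ t)))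
    {φ : ℝ × ℝ → ℝ} (hφ : ContDiff ℝ 1 φ) (hc : HasCompactSupport φ)
    (h0 : ∫ z, φ z ∂(μ 0) ≠ 0) {T : ℝ} (hT : 0 < T) :
    IntervalIntegrable (weakRate F μ φ) volume 0 T := by
  by_contra hni
  have hvan : ∀ z ∉ tsupport φ, φ z = 0 := fun z hz => image_eq_zero_of_notMem_tsupport hz
  have e1 := hsol.weak_eq (Φ := fun _ => φ) (hφ.comp contDiff_snd) hT.le hc
    (fun _ _ z hz => hvan z hz)
  have e2 := hsol.weak_eq (Φ := fun t z => (1 + t) * φ z)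
    ((contDiff_const.add contDiff_fst).mul (hφ.comp contDiff_snd)) hT.le hc
    (fun _ _ z hz => by simp [hvan z hz])
  simp only [deriv_const, zero_add] at e1
  rw [show (∫ s in (0:ℝ)..T, ∫ z, F (μ s) z * deriv (fun x => φ (x, z.2)) z.1 ∂(μ s)) = 0 from
    intervalIntegral.integral_undef hni] at e1
  have hcont : ContinuousOn (fun s => ∫ z, φ z ∂(μ s)) (uIcc 0 T) := by
    rw [uIcc_of_le hT.le]
    exact (hsol.1 φ hφ.continuous hc).mono Icc_subset_Ici_self
  have hrate : ∀ s ∈ uIcc 0 T, (∫ z, (deriv (fun u => (1 + u) * φ z) s +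
      F (μ s) z * deriv (fun x => (1 + s) * φ (x, z.2)) z.1) ∂(μ s))
      = (∫ z, φ z ∂(μ s)) + (1 + s) * weakRate F μ φ s := by
    intro s hs
    rw [uIcc_of_le hT.le] at hs
    have := hprob s hs.1
    have d1 : ∀ z, deriv (fun u => (1 + u) * φ z) s = φ z := fun z => by
      simp
    have d2 : ∀ z : ℝ × ℝ, deriv (fun x => (1 + s) * φ (x, z.2)) z.1
        = (1 + s) * deriv (fun x => φ (x, z.2)) z.1 := fun z => deriv_const_mul_field _
    simp_rw [d1, d2]
    rw [integral_add (hφ.continuous.integrable_of_hasCompactSupport hc), weakRate,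
      ← integral_const_mul]
    · congr 2; funext z; ring
    · refine ((integrable_mul_deriv_fst (hF s hs.1) hφ hc).const_mul (1 + s)).congr
        (Eventually.of_forall fun z => ?_)
      simp only; ring
  rw [intervalIntegral.integral_congr hrate, intervalIntegral.integral_undef] at e2
  · simp only [add_zero, integral_const_mul, one_mul] at e1 e2
    rw [e1] at e2
    apply h0
    have : T * ∫ z, φ z ∂(μ 0) = 0 := by linarith
    exact (mul_eq_zero.1 this).resolve_left hT.ne'
  · intro hint
    apply hni
    have h1 := (hint.sub hcont.intervalIntegrable).continuousOn_mul
      (g := fun s => (1 + s)⁻¹) (by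
        refine ContinuousOn.inv₀ (by fun_prop) fun s hs => ?_
        rw [uIcc_of_le hT.le] at hs
        linarith [hs.1])
    refine h1.congr fun s hs => ?_
    rw [uIoc_of_le hT.le] at hs
    have : (1 + s) ≠ 0 := by linarith [hs.1]
    field_simp
    ring

end

/-- A compactly supported `C¹` bump function on the plane, of size `R`. -/
def boxBump (R : ℝ) (z : ℝ × ℝ) : ℝ := quarticBump (z.1 / R) * quarticBump (z.2 / R)

lemma contDiff_boxBump (R : ℝ) : ContDiff ℝ 1 (boxBump R) :=
  (contDiff_quarticBump.comp (contDiff_fst.div_const R)).mul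
    (contDiff_quarticBump.comp (contDiff_snd.div_const R))

lemma boxBump_eq_zero {R : ℝ} (hR : 0 < R) {z : ℝ × ℝ}
    (hz : z ∉ Icc (-R) R ×ˢ Icc (-R) R) : boxBump R z = 0 := by
  have key : ∀ y : ℝ, y ∉ Icc (-R) R → quarticBump (y / R) = 0 := fun y hy => by
    refine quarticBump_of_one_le ?_
    rw [abs_div, abs_of_pos hR, le_div_iff₀ hR, one_mul]
    by_contra hlt
    exact hy (abs_le.1 (not_le.1 hlt).le)
  rw [mem_prod, not_and_or] at hz
  rcases hz with hz | hz
  · simp [boxBump, key _ hz]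
  · simp [boxBump, key _ hz]

lemma hasCompactSupport_boxBump {R : ℝ} (hR : 0 < R) : HasCompactSupport (boxBump R) :=
  HasCompactSupport.intro (isCompact_Icc.prod isCompact_Icc) fun _ hz => boxBump_eq_zero hR hz

lemma tendsto_div_nat_succ (y : ℝ) : Tendsto (fun n : ℕ => y / ((n : ℝ) + 1)) atTop (nhds 0) :=
  tendsto_const_nhds.div_atTop (tendsto_natCast_atTop_atTop.atTop_add tendsto_const_nhds)

lemma tendsto_quarticBump_div (y : ℝ) :
    Tendsto (fun n : ℕ => quarticBump (y / ((n : ℝ) + 1))) atTop (nhds 1) := by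
  have := (continuous_quarticBump.tendsto 0).comp (tendsto_div_nat_succ y)
  rwa [quarticBump_zero] at this

lemma abs_quarticBump_le_one (y : ℝ) : |quarticBump y| ≤ 1 := by
  rw [abs_of_nonneg (quarticBump_nonneg y)]; exact quarticBump_le_one y

lemma tendsto_integral_boxBump (ρ : Measure (ℝ × ℝ)) [IsProbabilityMeasure ρ] :
    Tendsto (fun n : ℕ => ∫ z, boxBump ((n : ℝ) + 1) z ∂ρ) atTop (nhds 1) := by
  have h := tendsto_integral_of_dominated_convergence (μ := ρ)
    (F := fun n : ℕ => boxBump ((n : ℝ) + 1)) (f := fun _ => (1:ℝ)) (fun _ => 1)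
    (fun n => (contDiff_boxBump _).continuous.aestronglyMeasurable) (integrable_const _)
    (fun n => Eventually.of_forall fun z => by
      rw [boxBump, norm_mul]
      exact mul_le_one₀ (abs_quarticBump_le_one _) (norm_nonneg _) (abs_quarticBump_le_one _))
    (Eventually.of_forall fun z => by
      simpa [boxBump] using (tendsto_quarticBump_div z.1).mul (tendsto_quarticBump_div z.2))
  simpa using h

/-- A truncated first coordinate. -/
def boxCoord (R : ℝ) (z : ℝ × ℝ) : ℝ := z.1 * boxBump R z

lemma contDiff_boxCoord (R : ℝ) : ContDiff ℝ 1 (boxCoord R) :=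
  contDiff_fst.mul (contDiff_boxBump R)

lemma hasCompactSupport_boxCoord {R : ℝ} (hR : 0 < R) : HasCompactSupport (boxCoord R) :=
  (hasCompactSupport_boxBump hR).mul_left

lemma deriv_boxCoord (R : ℝ) (z : ℝ × ℝ) :
    deriv (fun x => boxCoord R (x, z.2)) z.1 =
      (quarticBump (z.1 / R) + z.1 / R * quarticBumpDeriv (z.1 / R)) * quarticBump (z.2 / R) := by
  have h1 : HasDerivAt (fun x => quarticBump (x / R)) (quarticBumpDeriv (z.1 / R) * (1 / R)) z.1 :=
    HasDerivAt.comp (h₂ := quarticBump) z.1 (hasDerivAt_quarticBump (z.1 / R)) ((hasDerivAt_id z.1).div_const R)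
  have h2 := (hasDerivAt_id z.1).mul (h1.mul_const (quarticBump (z.2 / R)))
  refine Eq.trans (HasDerivAt.deriv h2) ?_
  simp only [id]
  ring

lemma abs_deriv_boxCoord_le (R : ℝ) (z : ℝ × ℝ) :
    |deriv (fun x => boxCoord R (x, z.2)) z.1| ≤ 5 := by
  rw [deriv_boxCoord, abs_mul]
  have h1 := abs_mul_quarticBumpDeriv_le (z.1 / R)
  rw [← abs_mul] at h1
  have h2 := abs_quarticBump_le_one (z.1 / R)
  have h3 := abs_quarticBump_le_one (z.2 / R)
  have h4 := abs_add_le (quarticBump (z.1 / R)) (z.1 / R * quarticBumpDeriv (z.1 / R))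
  have h5 := quarticBump_nonneg (z.1 / R)
  rw [abs_of_nonneg h5] at h4
  calc _ ≤ |quarticBump (z.1 / R) + z.1 / R * quarticBumpDeriv (z.1 / R)| * 1 := by gcongr
    _ ≤ 5 := by linarith

lemma tendsto_integral_deriv_boxCoord (ρ : Measure (ℝ × ℝ)) [IsProbabilityMeasure ρ] :
    Tendsto (fun n : ℕ => ∫ z, deriv (fun x => boxCoord ((n : ℝ) + 1) (x, z.2)) z.1 ∂ρ)
      atTop (nhds 1) := by
  have h := tendsto_integral_of_dominated_convergence (μ := ρ)
    (F := fun (n : ℕ) z => deriv (fun x => boxCoord ((n : ℝ) + 1) (x, z.2)) z.1)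
    (f := fun _ => (1:ℝ)) (fun _ => 5)
    (fun n => (continuous_deriv_fst (contDiff_boxCoord _)).aestronglyMeasurable)
    (integrable_const _) (fun n => Eventually.of_forall fun z => abs_deriv_boxCoord_le _ z)
    (Eventually.of_forall fun z => by
      simp_rw [deriv_boxCoord]
      have h1 := (tendsto_div_nat_succ z.1).mul
        ((continuous_quarticBumpDeriv.tendsto 0).comp (tendsto_div_nat_succ z.1))
      simpa using ((tendsto_quarticBump_div z.1).add h1).mul (tendsto_quarticBump_div z.2))
  simpa using h

section

variable {F : Measure (ℝ × ℝ) → ℝ × ℝ → ℝ} {μ : ℝ → Measure (ℝ × ℝ)}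

lemma IsSol.intervalIntegrable_weakRate (hsol : IsSol F μ)
    (hprob : ∀ t, 0 ≤ t → IsProbabilityMeasure (μ t)) (hF : ∀ t, 0 ≤ t → Continuous (F (μ t)))
    {φ : ℝ × ℝ → ℝ} (hφ : ContDiff ℝ 1 φ) (hc : HasCompactSupport φ) {T : ℝ} (hT : 0 < T) :
    IntervalIntegrable (weakRate F μ φ) volume 0 T := by
  by_cases h0 : ∫ z, φ z ∂(μ 0) = 0
  swap
  · exact hsol.intervalIntegrable_weakRate_of_ne hprob hF hφ hc h0 hT
  have := hprob 0 le_rfl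
  obtain ⟨n, hn⟩ := ((tendsto_integral_boxBump (μ 0)).eventually_ne one_ne_zero).exists
  set ψ := boxBump ((n : ℝ) + 1)
  have hψ : ContDiff ℝ 1 ψ := contDiff_boxBump _
  have hψc : HasCompactSupport ψ := hasCompactSupport_boxBump (by positivity)
  have i1 := hsol.intervalIntegrable_weakRate_of_ne hprob hF hψ hψc hn hT
  have i2 := hsol.intervalIntegrable_weakRate_of_ne hprob hF (hφ.add hψ) (hc.add hψc) (by
    rw [integral_congr_ae (g := fun z => φ z + ψ z) (Eventually.of_forall fun z => rfl),
      integral_add (hφ.continuous.integrable_of_hasCompactSupport hc)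
      (hψ.continuous.integrable_of_hasCompactSupport hψc), h0, zero_add]
    exact hn) hT
  refine (i2.sub i1).congr fun s hs => ?_
  rw [uIoc_of_le hT.le] at hs
  have := hprob s hs.1.le
  have hslice : ∀ {f : ℝ × ℝ → ℝ}, ContDiff ℝ 1 f → ∀ z : ℝ × ℝ,
      DifferentiableAt ℝ (fun x => f (x, z.2)) z.1 := fun hf z =>
    ((hf.comp (contDiff_id.prodMk contDiff_const)).differentiable one_ne_zero) z.1
  have hd : ∀ z : ℝ × ℝ, deriv (fun x => φ (x, z.2) + ψ (x, z.2)) z.1 =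
      deriv (fun x => φ (x, z.2)) z.1 + deriv (fun x => ψ (x, z.2)) z.1 := fun z =>
    deriv_fun_add (hslice hφ z) (hslice hψ z)
  simp only [weakRate, hd, mul_add]
  rw [integral_add (integrable_mul_deriv_fst (hF s hs.1.le) hφ hc)
    (integrable_mul_deriv_fst (hF s hs.1.le) hψ hψc), add_sub_cancel_right]

lemma LipFlow.intervalIntegrable_velocity {X : ℝ → ℝ → ℝ → ℝ} {c L : ℝ}
    (h : LipFlow (fun t => F (μ t)) X c L) (hsol : IsSol F μ)
    (hprob : ∀ t, 0 ≤ t → IsProbabilityMeasure (μ t)) (hF : ∀ t, 0 ≤ t → Continuous (F (μ t)))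
    (x₀ ω₀ : ℝ) {T : ℝ} (hT : 0 < T) :
    IntervalIntegrable (fun s => F (μ s) (X s x₀ ω₀, ω₀)) volume 0 T := by
  set v : ℝ → ℝ := fun s => F (μ s) (X s x₀ ω₀, ω₀) with hv
  have hmeas : AEStronglyMeasurable v (volume.restrict (Icc 0 T)) := by
    have := aestronglyMeasurable_of_hasDerivAt hT.le (fun t ht => h.ode x₀ ω₀ t ht)
    rwa [uIoc_of_le hT.le, restrict_Ioc_eq_restrict_Icc] at this
  rw [intervalIntegrable_iff_integrableOn_Icc_of_le hT.le]
  refine LocallyIntegrableOn.integrableOn_isCompact (fun s₀ hs₀ => ?_) isCompact_Icc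
  have := hprob s₀ hs₀.1
  obtain ⟨n, hn⟩ := ((tendsto_integral_deriv_boxCoord (μ s₀)).eventually
    (lt_mem_nhds (by norm_num : (1/2 : ℝ) < 1))).exists
  have hR : (0:ℝ) < (n : ℝ) + 1 := by positivity
  set R : ℝ := (n : ℝ) + 1
  set φ' : ℝ × ℝ → ℝ := fun z => deriv (fun x => boxCoord R (x, z.2)) z.1 with hφ'
  have hφc : Continuous φ' := continuous_deriv_fst (contDiff_boxCoord R)
  have hφs : HasCompactSupport φ' :=
    hasCompactSupport_deriv_fst (contDiff_boxCoord R) (hasCompactSupport_boxCoord hR)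
  have hw : ContinuousWithinAt (fun s => ∫ z, φ' z ∂(μ s)) (Icc 0 T) s₀ :=
    ((hsol.1 φ' hφc hφs).mono Icc_subset_Ici_self) s₀ hs₀
  obtain ⟨δ, hδ, hball⟩ := Metric.mem_nhdsWithin_iff.1 (hw.eventually (lt_mem_nhds hn))
  obtain ⟨Cx, hCx⟩ := isCompact_Icc.exists_bound_of_continuousOn (h.continuousOn_time x₀ ω₀ T)
  set E : ℝ := 5 * (c * (Cx + R) + L * (|ω₀| + R)) with hE
  have hrate := (intervalIntegrable_iff_integrableOn_Icc_of_le hT.le).1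
    (hsol.intervalIntegrable_weakRate hprob hF (contDiff_boxCoord R)
      (hasCompactSupport_boxCoord hR) hT)
  have hsub : Metric.ball s₀ δ ∩ Icc 0 T ⊆ Icc 0 T := inter_subset_right
  refine ⟨Metric.ball s₀ δ ∩ Icc 0 T, Filter.inter_mem
    (mem_nhdsWithin_of_mem_nhds (Metric.ball_mem_nhds s₀ hδ)) self_mem_nhdsWithin, ?_⟩
  have hms : MeasurableSet (Metric.ball s₀ δ ∩ Icc 0 T) :=
    measurableSet_ball.inter measurableSet_Icc
  have hdom : IntegrableOn (fun s => 2 * (|weakRate F μ (boxCoord R) s| + E))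
      (Metric.ball s₀ δ ∩ Icc 0 T) := by
    have i1 : IntegrableOn (fun s => 2 * (|weakRate F μ (boxCoord R) s| + E)) (Icc 0 T) :=
      (hrate.abs.add (integrable_const E)).const_mul 2
    exact i1.mono_set hsub
  refine Integrable.mono' hdom (hmeas.mono_measure (Measure.restrict_mono hsub le_rfl)) ?_
  refine ae_restrict_of_forall_mem hms fun s hs => ?_
  have hw2 : 1 / 2 < ∫ z, φ' z ∂(μ s) := hball hs
  have hsI := hs.2
  have := hprob s hsI.1
  have hdiff : |v s * (∫ z, φ' z ∂(μ s)) - weakRate F μ (boxCoord R) s| ≤ E := by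
    rw [weakRate, ← integral_const_mul, ← integral_sub
      ((hφc.integrable_of_hasCompactSupport hφs).const_mul _)
      (integrable_mul_deriv_fst (hF s hsI.1) (contDiff_boxCoord R)
        (hasCompactSupport_boxCoord hR))]
    have hb : ∀ z, ‖v s * φ' z - F (μ s) z * φ' z‖ ≤ E := by
      intro z
      have hCx0 := hCx s hsI
      have hCxn : 0 ≤ Cx := (norm_nonneg _).trans hCx0
      have hE0 : 0 ≤ E := by
        have := h.c_pos
        have := h.L_nonneg
        positivity
      rw [← sub_mul, norm_mul, mul_comm]
      by_cases hz : φ' z = 0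
      · simpa [hz] using hE0
      have hzR : z ∈ Icc (-R) R ×ˢ Icc (-R) R := by
        by_contra hzn
        apply hz
        have hcl : (Icc (-R) R ×ˢ Icc (-R) R)ᶜ ∈ nhds z :=
          (isClosed_Icc.prod isClosed_Icc).isOpen_compl.mem_nhds hzn
        have hev : (fun x => boxCoord R (x, z.2)) =ᶠ[nhds z.1] fun _ => 0 := by
          have hct : Tendsto (fun x : ℝ => (x, z.2)) (nhds z.1) (nhds z) :=
            (Continuous.prodMk continuous_id continuous_const).tendsto' _ _ rfl
          filter_upwards [hct hcl] with x hx
          simp [boxCoord, boxBump_eq_zero hR hx]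
        simp [hφ', hev.deriv_eq]
      have h1 := h.lip s hsI.1 (X s x₀ ω₀, ω₀) z
      have h2 : |X s x₀ ω₀ - z.1| ≤ Cx + R :=
        (abs_sub _ _).trans (add_le_add hCx0 (abs_le.2 hzR.1))
      have h3 : |ω₀ - z.2| ≤ |ω₀| + R := (abs_sub _ _).trans (by gcongr; exact abs_le.2 hzR.2)
      have h4 : ‖φ' z‖ ≤ 5 := abs_deriv_boxCoord_le R z
      rw [hE]
      refine mul_le_mul h4 (h1.trans ?_) (norm_nonneg _) (by norm_num)
      have := h.c_pos
      have := h.L_nonneg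
      gcongr
    have := norm_integral_le_of_norm_le_const (μ := μ s) (Eventually.of_forall hb)
    simpa using this
  have h5 : |v s| * (1 / 2) ≤ |v s * (∫ z, φ' z ∂(μ s))| := by
    rw [abs_mul, abs_of_pos (by linarith : 0 < ∫ z, φ' z ∂(μ s))]
    gcongr
  have h6 := abs_sub_abs_le_abs_sub (v s * (∫ z, φ' z ∂(μ s))) (weakRate F μ (boxCoord R) s)
  rw [Real.norm_eq_abs]
  linarith

end

/-- Grönwall's inequality in integral form, with a constant coefficient. -/
lemma le_mul_exp_of_le_add_integral {D : ℝ → ℝ} {T k K : ℝ} (hT : 0 ≤ T) (hk : 0 ≤ k)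
    (hD : ContinuousOn D (Icc 0 T)) (hD0 : ∀ t ∈ Icc 0 T, 0 ≤ D t)
    (hle : ∀ t ∈ Icc 0 T, D t ≤ K + k * ∫ s in (0:ℝ)..t, D s) : D T ≤ K * exp (k * T) := by
  set E : ℝ → ℝ := fun t => D (max 0 (min t T)) with hE
  have hmem : ∀ t, max 0 (min t T) ∈ Icc 0 T := fun t =>
    ⟨le_max_left _ _, max_le hT (min_le_right _ _)⟩
  have hEc : Continuous E := hD.comp_continuous (by fun_prop) hmem
  have hED : ∀ t ∈ Icc 0 T, E t = D t := fun t ht => by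
    rw [hE]; simp only [min_eq_left ht.2, max_eq_right ht.1]
  have hint : ∀ t ∈ Icc 0 T, ∫ s in (0:ℝ)..t, D s = ∫ s in (0:ℝ)..t, E s := fun t ht => by
    refine intervalIntegral.integral_congr fun s hs => ?_
    rw [uIcc_of_le ht.1] at hs
    exact (hED s ⟨hs.1, hs.2.trans ht.2⟩).symm
  set g : ℝ → ℝ := fun t => K + k * ∫ s in (0:ℝ)..t, E s with hg
  have hgd : ∀ t, HasDerivAt g (k * E t) t := fun t =>
    ((hEc.integral_hasStrictDerivAt 0 t).hasDerivAt.const_mul k).const_add K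
  have hDg : ∀ t ∈ Icc 0 T, D t ≤ g t := fun t ht => by
    rw [hg]; simp only; rw [← hint t ht]; exact hle t ht
  have key := norm_le_gronwallBound_of_norm_deriv_right_le (f := g) (f' := fun t => k * E t)
    (δ := K) (K := k) (ε := 0) (a := 0) (b := T)
    (fun t _ => (hgd t).continuousAt.continuousWithinAt)
    (fun t _ => (hgd t).hasDerivWithinAt)
    (by
      have h0 : (0:ℝ) ∈ Icc 0 T := ⟨le_rfl, hT⟩
      have := (hD0 0 h0).trans (hDg 0 h0)
      simp only [hg, intervalIntegral.integral_same, mul_zero, add_zero] at this ⊢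
      rw [Real.norm_of_nonneg this])
    (fun t ht => by
      have ht' : t ∈ Icc 0 T := ⟨ht.1, ht.2.le⟩
      have h1 := hDg t ht'
      have h2 := hD0 t ht'
      rw [hED t ht', Real.norm_of_nonneg (mul_nonneg hk h2), Real.norm_of_nonneg (h2.trans h1),
        add_zero]
      gcongr) T ⟨hT, le_rfl⟩
  rw [gronwallBound_ε0, sub_zero] at key
  exact (hDg T ⟨hT, le_rfl⟩).trans ((le_abs_self _).trans key)

lemma integrable_mul_comp_snd {ρ : Measure (ℝ × ℝ)} [IsProbabilityMeasure ρ] {χ f : ℝ → ℝ}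
    (hχ : Continuous χ) (hχc : HasCompactSupport χ) (hf : Continuous f) (hf1 : ∀ y, |f y| ≤ 1)
    (a r : ℝ) : Integrable (fun z : ℝ × ℝ => f ((z.1 - a) / r) * χ z.2) ρ := by
  obtain ⟨C, hC⟩ := hχc.exists_bound_of_continuous hχ
  refine Integrable.of_bound (by fun_prop) C (Eventually.of_forall fun z => ?_)
  rw [norm_mul]
  calc _ ≤ 1 * C := by
        gcongr
        · exact hf1 _
        · exact hC _
    _ = C := one_mul C

section

variable {F : Measure (ℝ × ℝ) → ℝ × ℝ → ℝ} {μ : ℝ → Measure (ℝ × ℝ)}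

lemma IsSol.continuousOn_integral_moving (hsol : IsSol F μ)
    (hprob : ∀ t, 0 ≤ t → IsProbabilityMeasure (μ t)) {a χ : ℝ → ℝ} (ha : Continuous a)
    (hχ : Continuous χ) (hχc : HasCompactSupport χ) {r : ℝ} (hr : 0 < r) :
    ContinuousOn (fun t => ∫ z, quarticBump ((z.1 - a t) / r) * χ z.2 ∂(μ t)) (Ici 0) := by
  intro t₀ ht₀
  obtain ⟨C, hC⟩ := hχc.exists_bound_of_continuous hχ
  have hC0 : 0 ≤ C := (norm_nonneg _).trans (hC 0)
  have hΦc : Continuous fun z : ℝ × ℝ => quarticBump ((z.1 - a t₀) / r) * χ z.2 := by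
    have := continuous_quarticBump
    fun_prop
  have hΦs : HasCompactSupport fun z : ℝ × ℝ => quarticBump ((z.1 - a t₀) / r) * χ z.2 := by
    refine HasCompactSupport.intro (K := Icc (a t₀ - r) (a t₀ + r) ×ˢ tsupport χ)
      (isCompact_Icc.prod hχc) fun z hz => ?_
    rw [mem_prod, not_and_or] at hz
    rcases hz with hz | hz
    · rw [quarticBump_of_one_le, zero_mul]
      rw [abs_div, abs_of_pos hr, le_div_iff₀ hr, one_mul]
      by_contra hlt
      have := abs_lt.1 (not_le.1 hlt)
      exact hz ⟨by linarith, by linarith⟩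
    · rw [image_eq_zero_of_notMem_tsupport hz, mul_zero]
  have h1 := hsol.1 _ hΦc hΦs t₀ ht₀
  have h2 : Tendsto (fun t => (∫ z, quarticBump ((z.1 - a t) / r) * χ z.2 ∂(μ t)) -
      ∫ z, quarticBump ((z.1 - a t₀) / r) * χ z.2 ∂(μ t)) (nhdsWithin t₀ (Ici 0)) (nhds 0) := by
    refine squeeze_zero_norm' (a := fun t => 4 * (|a t - a t₀| / r) * C) ?_ ?_
    · filter_upwards [self_mem_nhdsWithin] with t ht
      have := hprob t ht
      have hq : ∀ b, Integrable (fun z : ℝ × ℝ => quarticBump ((z.1 - b) / r) * χ z.2) (μ t) :=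
        fun b => integrable_mul_comp_snd hχ hχc continuous_quarticBump abs_quarticBump_le_one b r
      rw [← integral_sub (hq _) (hq _)]
      have := norm_integral_le_of_norm_le_const (μ := μ t)
        (f := fun z : ℝ × ℝ => quarticBump ((z.1 - a t) / r) * χ z.2 -
          quarticBump ((z.1 - a t₀) / r) * χ z.2) (C := 4 * (|a t - a t₀| / r) * C)
        (Eventually.of_forall fun z => by
          rw [← sub_mul, norm_mul]
          have e1 := abs_quarticBump_sub_le ((z.1 - a t) / r) ((z.1 - a t₀) / r)
          rw [← sub_div, abs_div, abs_of_pos hr,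
            show z.1 - a t - (z.1 - a t₀) = -(a t - a t₀) by ring, abs_neg] at e1
          exact mul_le_mul e1 (hC _) (norm_nonneg _) (by positivity))
      simpa using this
    · have : Tendsto (fun t => 4 * (|a t - a t₀| / r) * C) (nhds t₀) (nhds 0) :=
        Continuous.tendsto' (by fun_prop) _ _ (by simp)
      exact this.mono_left nhdsWithin_le_nhds
  have h3 := h2.add h1.tendsto
  simp only [sub_add_cancel, zero_add] at h3
  exact h3

lemma LipFlow.tube_estimate_of_approx {X : ℝ → ℝ → ℝ → ℝ} {c L : ℝ}
    (h : LipFlow (fun t => F (μ t)) X c L) (hsol : IsSol F μ)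
    (hprob : ∀ t, 0 ≤ t → IsProbabilityMeasure (μ t))
    {ν : Measure ℝ} (hmarg : ∀ t, 0 ≤ t → (μ t).map Prod.snd = ν)
    {x₀ ω₀ T : ℝ} (hT : 0 < T)
    {χ : ℝ → ℝ} (hχ : ContDiff ℝ 1 χ) (hχc : HasCompactSupport χ) (hχ0 : ∀ ω, 0 ≤ χ ω)
    {ε : ℝ} (hε : ∀ ω, χ ω ≠ 0 → |ω - ω₀| ≤ ε) {r : ℝ} (hr : 0 < r)
    {a u : ℝ → ℝ} (ha0 : a 0 = x₀) (hu : Continuous u) (ha : ∀ t, HasDerivAt a (u t) t) {η : ℝ}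
    (haX : ∀ t ∈ Icc 0 T, |a t - X t x₀ ω₀| ≤ η)
    (hv : IntervalIntegrable (fun s => F (μ s) (X s x₀ ω₀, ω₀)) volume 0 T)
    (hη : ∫ s in (0:ℝ)..T, |F (μ s) (X s x₀ ω₀, ω₀) - u s| ≤ η) :
    ∫ z, (1 - quarticBump ((z.1 - a T) / r)) * χ z.2 ∂(μ T) ≤
      ((∫ z, (1 - quarticBump ((z.1 - x₀) / r)) * χ z.2 ∂(μ 0)) +
        4 / r * (∫ ω, χ ω ∂ν) * ((L * ε + c * η) * T + η)) * exp (4 * c * T) := by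
  have hc0 := h.c_pos
  have hL0 := h.L_nonneg
  have hac : Continuous a := continuous_iff_continuousAt.2 fun t => (ha t).continuousAt
  have hac1 : ContDiff ℝ 1 a := by
    rw [contDiff_one_iff_deriv]
    refine ⟨fun t => (ha t).differentiableAt, ?_⟩
    rwa [show deriv a = u from funext fun t => (ha t).deriv]
  set v : ℝ → ℝ := fun s => F (μ s) (X s x₀ ω₀, ω₀) with hvdef
  set m : ℝ := ∫ ω, χ ω ∂ν with hm
  have hm0 : 0 ≤ m := integral_nonneg hχ0
  have hmt : ∀ t, 0 ≤ t → ∫ z, χ z.2 ∂(μ t) = m := fun t ht => by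
    rw [hm, ← hmarg t ht, integral_map measurable_snd.aemeasurable
      hχ.continuous.aestronglyMeasurable]
  have hχi : ∀ t, 0 ≤ t → Integrable (fun z : ℝ × ℝ => χ z.2) (μ t) := fun t ht => by
    have := hprob t ht
    simpa using integrable_mul_comp_snd (ρ := μ t) (f := fun _ => 1) hχ.continuous hχc
      continuous_const (by simp) 0 1
  have hqi : ∀ t, 0 ≤ t → ∀ b,
      Integrable (fun z : ℝ × ℝ => quarticBump ((z.1 - b) / r) * χ z.2) (μ t) := fun t ht b => by
    have := hprob t ht
    exact integrable_mul_comp_snd hχ.continuous hχc continuous_quarticBump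
      abs_quarticBump_le_one b r
  set P : ℝ → ℝ := fun t => ∫ z, quarticBump ((z.1 - a t) / r) * χ z.2 ∂(μ t) with hP
  set D : ℝ → ℝ := fun t => ∫ z, (1 - quarticBump ((z.1 - a t) / r)) * χ z.2 ∂(μ t) with hD
  have hDi : ∀ t, 0 ≤ t → ∀ b,
      Integrable (fun z : ℝ × ℝ => (1 - quarticBump ((z.1 - b) / r)) * χ z.2) (μ t) :=
    fun t ht b => by
      simp_rw [sub_mul, one_mul]
      exact (hχi t ht).sub (hqi t ht b)
  have hDP : ∀ t, 0 ≤ t → D t = m - P t := fun t ht => by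
    rw [hD, hP]
    simp_rw [sub_mul, one_mul]
    rw [integral_sub (hχi t ht) (hqi t ht _), hmt t ht]
  have hDc : ContinuousOn D (Icc 0 T) := by
    refine (continuousOn_const.sub ((hsol.continuousOn_integral_moving hprob hac hχ.continuous
      hχc hr).mono Icc_subset_Ici_self)).congr fun t ht => hDP t ht.1
  have hD0 : ∀ t, 0 ≤ D t := fun t => integral_nonneg fun z =>
    mul_nonneg (sub_nonneg.2 (quarticBump_le_one _)) (hχ0 _)
  obtain ⟨Ca, hCa⟩ := (isCompact_Icc (a := -(T + 2)) (b := T + 2)).exists_bound_of_continuousOn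
    hac.continuousOn
  let rate : ℝ → ℝ := fun s => ∫ z,
      (deriv (fun τ => quarticBump ((z.1 - a τ) / r) * χ z.2) s +
        F (μ s) z * deriv (fun x => quarticBump ((x - a s) / r) * χ z.2) z.1) ∂(μ s)
  have hweak : ∀ t ∈ Icc 0 T, P t = P 0 + ∫ s in (0:ℝ)..t, rate s := by
    intro t ht
    refine hsol.weak_eq (Φ := fun t z => quarticBump ((z.1 - a t) / r) * χ z.2) ?_ ht.1
      (K := Icc (-(Ca + r)) (Ca + r) ×ˢ tsupport χ) (isCompact_Icc.prod hχc) ?_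
    · refine ContDiff.mul (contDiff_quarticBump.comp (ContDiff.div_const ?_ r))
        (hχ.comp (contDiff_snd.comp contDiff_snd))
      exact (contDiff_fst.comp contDiff_snd).sub (hac1.comp contDiff_fst)
    · intro τ hτ z hz
      rw [mem_prod, not_and_or] at hz
      rcases hz with hz | hz
      · rw [quarticBump_of_one_le, zero_mul]
        rw [abs_div, abs_of_pos hr, le_div_iff₀ hr, one_mul]
        by_contra hlt
        have e1 := abs_lt.1 (not_le.1 hlt)
        have e2 := abs_le.1 (hCa τ (abs_le.1 (hτ.trans (by linarith [ht.2]))))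
        exact hz ⟨by linarith, by linarith⟩
      · rw [image_eq_zero_of_notMem_tsupport hz, mul_zero]
  have hrate : ∀ s ∈ Icc 0 T, |rate s| ≤
      4 * c * D s + 4 / r * m * (L * ε + c * η + |v s - u s|) := by
    intro s hs
    have hpt : ∀ z : ℝ × ℝ, ‖deriv (fun τ => quarticBump ((z.1 - a τ) / r) * χ z.2) s +
        F (μ s) z * deriv (fun x => quarticBump ((x - a s) / r) * χ z.2) z.1‖ ≤
        4 * c * ((1 - quarticBump ((z.1 - a s) / r)) * χ z.2) +
          4 / r * (L * ε + c * η + |v s - u s|) * χ z.2 := by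
      intro z
      set y := (z.1 - a s) / r with hy
      have d1 : HasDerivAt (fun τ => quarticBump ((z.1 - a τ) / r) * χ z.2)
          (quarticBumpDeriv y * (-u s / r) * χ z.2) s :=
        (HasDerivAt.comp (h₂ := quarticBump) s (hasDerivAt_quarticBump y)
          (((ha s).const_sub z.1).div_const r)).mul_const _
      have d2 : HasDerivAt (fun x => quarticBump ((x - a s) / r) * χ z.2)
          (quarticBumpDeriv y * (1 / r) * χ z.2) z.1 :=
        (HasDerivAt.comp (h₂ := quarticBump) z.1 (hasDerivAt_quarticBump y)
          (((hasDerivAt_id z.1).sub_const (a s)).div_const r)).mul_const _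
      rw [d1.deriv, d2.deriv, show quarticBumpDeriv y * (-u s / r) * χ z.2 +
        F (μ s) z * (quarticBumpDeriv y * (1 / r) * χ z.2) =
        (quarticBumpDeriv y / r * (F (μ s) z - u s)) * χ z.2 by ring, norm_mul,
        Real.norm_of_nonneg (hχ0 z.2)]
      by_cases hz : χ z.2 = 0
      · simp [hz]
      rw [← mul_assoc, ← add_mul]
      refine mul_le_mul_of_nonneg_right ?_ (hχ0 _)
      have l1 := h.lip s hs.1 z (X s x₀ ω₀, ω₀)
      have l2 := hε z.2 hz
      have l3 : |z.1 - X s x₀ ω₀| ≤ |z.1 - a s| + η :=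
        (_root_.abs_sub_le z.1 (a s) _).trans (by gcongr; exact haX s hs)
      have l4 : |F (μ s) z - u s| ≤
          c * |z.1 - a s| + (L * ε + c * η + |v s - u s|) := by
        calc |F (μ s) z - u s| ≤ |F (μ s) z - v s| + |v s - u s| :=
            _root_.abs_sub_le _ _ _
          _ ≤ c * (|z.1 - a s| + η) + L * ε + |v s - u s| := by
            gcongr
            exact l1.trans (by gcongr)
          _ = _ := by ring
      have l5 : |z.1 - a s| = r * |y| := by
        rw [hy, abs_div, abs_of_pos hr]; field_simp
      rw [norm_mul, norm_div, Real.norm_of_nonneg hr.le]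
      have b1 := abs_mul_quarticBumpDeriv_le y
      have b2 := abs_quarticBumpDeriv_le y
      have hrest : 0 ≤ L * ε + c * η + |v s - u s| := by
        have e1 := (abs_nonneg _).trans l2
        have e2 := (abs_nonneg _).trans (haX s hs)
        positivity
      calc |quarticBumpDeriv y| / r * ‖F (μ s) z - u s‖
          ≤ |quarticBumpDeriv y| / r * (c * (r * |y|) + (L * ε + c * η + |v s - u s|)) := by
            rw [← l5]; gcongr; exact l4
        _ = c * (|y| * |quarticBumpDeriv y|) +
            |quarticBumpDeriv y| / r * (L * ε + c * η + |v s - u s|) := by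
            field_simp
        _ ≤ c * (4 * (1 - quarticBump y)) + 4 / r * (L * ε + c * η + |v s - u s|) := by
            gcongr
        _ = _ := by ring
    have hb := norm_integral_le_of_norm_le (μ := μ s)
      (((hDi s hs.1 (a s)).const_mul (4 * c)).add
        ((hχi s hs.1).const_mul (4 / r * (L * ε + c * η + |v s - u s|))))
      (Eventually.of_forall hpt)
    rw [integral_add' ((hDi s hs.1 (a s)).const_mul (4 * c))
      ((hχi s hs.1).const_mul _), integral_const_mul, integral_const_mul, hmt s hs.1] at hb
    refine hb.trans (le_of_eq ?_)
    rw [hD]; ring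
  have hvu : IntervalIntegrable (fun s => |v s - u s|) volume 0 T :=
    (hv.sub (hu.intervalIntegrable 0 T)).abs
  refine le_mul_exp_of_le_add_integral (D := D) hT.le (by positivity) hDc (fun t _ => hD0 t) ?_
  intro t ht
  have hsub : uIcc 0 t ⊆ uIcc 0 T := by
    rw [uIcc_of_le ht.1, uIcc_of_le hT.le]; exact Icc_subset_Icc_right ht.2
  have i1 : IntervalIntegrable (fun s => 4 * c * D s) volume 0 t :=
    ((hDc.mono (Icc_subset_Icc_right ht.2)).intervalIntegrable_of_Icc ht.1).const_mul _
  have i2 : IntervalIntegrable (fun s => |v s - u s|) volume 0 t := hvu.mono_set hsub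
  have i3 : IntervalIntegrable (fun s => 4 / r * m * (L * ε + c * η + |v s - u s|)) volume 0 t :=
    (intervalIntegrable_const.add i2).const_mul _
  have hbound := intervalIntegral.norm_integral_le_of_norm_le (f := rate) ht.1
    (Eventually.of_forall fun s hs => hrate s ⟨hs.1.le, hs.2.trans ht.2⟩) (i1.add i3)
  rw [intervalIntegral.integral_add i1 i3, intervalIntegral.integral_const_mul,
    intervalIntegral.integral_const_mul,
    intervalIntegral.integral_add intervalIntegrable_const i2,
    intervalIntegral.integral_const] at hbound
  have hmono : ∫ s in (0:ℝ)..t, |v s - u s| ≤ η :=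
    (intervalIntegral.integral_mono_interval le_rfl ht.1 ht.2
      (Eventually.of_forall fun s => abs_nonneg _) hvu).trans hη
  have hw := hweak t ht
  have hP1 := hDP t ht.1
  have hP2 := hDP 0 le_rfl
  have hD00 : D 0 = ∫ z, (1 - quarticBump ((z.1 - x₀) / r)) * χ z.2 ∂(μ 0) := by
    rw [hD, ← ha0]
  rw [← hD00]
  have hη0 : 0 ≤ η := (abs_nonneg _).trans (haX t ht)
  have hneg := neg_le_of_abs_le hbound
  have hfin : 4 / r * m * ((t - 0) • (L * ε + c * η) + ∫ s in (0:ℝ)..t, |v s - u s|) ≤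
      4 / r * m * ((L * ε + c * η) * T + η) := by
    by_cases hmz : m = 0
    · simp [hmz]
    have hε0 : 0 ≤ ε := by
      by_contra hlt
      apply hmz
      rw [hm]
      refine integral_eq_zero_of_ae (Eventually.of_forall fun ω => ?_)
      by_contra hω
      exact hlt ((abs_nonneg _).trans (hε ω hω))
    have ht2 := ht.2
    rw [smul_eq_mul, sub_zero, mul_comm t]
    gcongr
  linarith

end

lemma exists_continuous_intervalIntegral_sub_le {v : ℝ → ℝ} {T : ℝ} (hT : 0 ≤ T)
    (hv : IntervalIntegrable v volume 0 T) {η : ℝ} (hη : 0 < η) :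
    ∃ u : ℝ → ℝ, Continuous u ∧ ∫ s in (0:ℝ)..T, |v s - u s| ≤ η := by
  have hvi : Integrable ((Ioc 0 T).indicator v) volume :=
    (integrable_indicator_iff measurableSet_Ioc).2
      ((intervalIntegrable_iff_integrableOn_Ioc_of_le hT).1 hv)
  obtain ⟨u, -, hu, huc, hui⟩ := hvi.exists_hasCompactSupport_integral_sub_le hη
  refine ⟨u, huc, le_trans ?_ hu⟩
  rw [intervalIntegral.integral_of_le hT]
  refine le_trans (le_of_eq ?_) (setIntegral_le_integral (s := Ioc 0 T) (hvi.sub hui).norm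
    (Eventually.of_forall fun s => norm_nonneg _))
  refine setIntegral_congr_fun measurableSet_Ioc fun s hs => ?_
  simp [indicator_of_mem hs]

section

variable {F : Measure (ℝ × ℝ) → ℝ × ℝ → ℝ} {μ : ℝ → Measure (ℝ × ℝ)}

/-- Mass of `μ t` near the frequency `ω₀` follows the characteristic from `(x₀, ω₀)`. -/
lemma LipFlow.tube_estimate {X : ℝ → ℝ → ℝ → ℝ} {c L : ℝ}
    (h : LipFlow (fun t => F (μ t)) X c L) (hsol : IsSol F μ)
    (hprob : ∀ t, 0 ≤ t → IsProbabilityMeasure (μ t)) (hF : ∀ t, 0 ≤ t → Continuous (F (μ t)))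
    {ν : Measure ℝ} (hmarg : ∀ t, 0 ≤ t → (μ t).map Prod.snd = ν)
    (x₀ ω₀ : ℝ) {T : ℝ} (hT : 0 < T)
    {χ : ℝ → ℝ} (hχ : ContDiff ℝ 1 χ) (hχc : HasCompactSupport χ) (hχ0 : ∀ ω, 0 ≤ χ ω)
    {ε : ℝ} (hε : ∀ ω, χ ω ≠ 0 → |ω - ω₀| ≤ ε) {r : ℝ} (hr : 0 < r) :
    ∫ z, (1 - quarticBump ((z.1 - X T x₀ ω₀) / r)) * χ z.2 ∂(μ T) ≤
      ((∫ z, (1 - quarticBump ((z.1 - x₀) / r)) * χ z.2 ∂(μ 0)) +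
        4 / r * (∫ ω, χ ω ∂ν) * (L * ε * T)) * exp (4 * c * T) := by
  have hv := h.intervalIntegrable_velocity hsol hprob hF x₀ ω₀ hT
  set v : ℝ → ℝ := fun s => F (μ s) (X s x₀ ω₀, ω₀) with hvdef
  set m : ℝ := ∫ ω, χ ω ∂ν with hm
  set K₀ : ℝ := ∫ z, (1 - quarticBump ((z.1 - x₀) / r)) * χ z.2 ∂(μ 0)
  have := hprob T hT.le
  have hmT : ∫ z, χ z.2 ∂(μ T) = m := by
    rw [hm, ← hmarg T hT.le, integral_map measurable_snd.aemeasurable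
      hχ.continuous.aestronglyMeasurable]
  have hχi : Integrable (fun z : ℝ × ℝ => χ z.2) (μ T) := by
    simpa using integrable_mul_comp_snd (ρ := μ T) (f := fun _ => 1) hχ.continuous hχc
      continuous_const (by simp) 0 1
  have hDi : ∀ b, Integrable (fun z : ℝ × ℝ => (1 - quarticBump ((z.1 - b) / r)) * χ z.2) (μ T) :=
    fun b => by
      simp_rw [sub_mul, one_mul]
      exact hχi.sub (integrable_mul_comp_snd hχ.continuous hχc continuous_quarticBump
        abs_quarticBump_le_one b r)
  have main : ∀ η : ℝ, 0 < η →
      ∫ z, (1 - quarticBump ((z.1 - X T x₀ ω₀) / r)) * χ z.2 ∂(μ T) ≤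
        (K₀ + 4 / r * m * ((L * ε + c * η) * T + η)) * exp (4 * c * T) + 4 / r * η * m := by
    intro η hη
    obtain ⟨u, hu, huv⟩ := exists_continuous_intervalIntegral_sub_le hT.le hv hη
    have hvu : IntervalIntegrable (fun s => |v s - u s|) volume 0 T :=
      (hv.sub (hu.intervalIntegrable 0 T)).abs
    set a : ℝ → ℝ := fun t => x₀ + ∫ s in (0:ℝ)..t, u s with ha
    have had : ∀ t, HasDerivAt a (u t) t := fun t =>
      (hu.integral_hasStrictDerivAt 0 t).hasDerivAt.const_add x₀
    have haX : ∀ t ∈ Icc 0 T, |a t - X t x₀ ω₀| ≤ η := by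
      intro t ht
      have hvt : IntervalIntegrable v volume 0 t := hv.mono_set (by
        rw [uIcc_of_le ht.1, uIcc_of_le hT.le]; exact Icc_subset_Icc_right ht.2)
      have hftc : ∫ s in (0:ℝ)..t, v s = X t x₀ ω₀ - X 0 x₀ ω₀ :=
        intervalIntegral.integral_eq_sub_of_hasDerivAt (f := fun s => X s x₀ ω₀) (fun s hs => by
          rw [uIcc_of_le ht.1] at hs
          exact h.ode x₀ ω₀ s hs.1) hvt
      rw [h.init] at hftc
      have e1 : a t - X t x₀ ω₀ = -∫ s in (0:ℝ)..t, (v s - u s) := by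
        rw [intervalIntegral.integral_sub hvt (hu.intervalIntegrable 0 t), hftc, ha]
        ring
      rw [e1, abs_neg]
      exact (intervalIntegral.abs_integral_le_integral_abs ht.1).trans
        ((intervalIntegral.integral_mono_interval le_rfl ht.1 ht.2
          (Eventually.of_forall fun s => abs_nonneg _) hvu).trans huv)
    have key := h.tube_estimate_of_approx hsol hprob hmarg hT hχ hχc hχ0 hε hr
      (by simp [ha]) hu had haX hv huv
    have hcmp : ∫ z, (1 - quarticBump ((z.1 - X T x₀ ω₀) / r)) * χ z.2 ∂(μ T) ≤
        ∫ z, ((1 - quarticBump ((z.1 - a T) / r)) * χ z.2 + 4 / r * η * χ z.2) ∂(μ T) := by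
      refine integral_mono (hDi _) ((hDi _).add (hχi.const_mul _)) fun z => ?_
      simp only
      rw [← add_mul]
      refine mul_le_mul_of_nonneg_right ?_ (hχ0 _)
      have e1 := abs_quarticBump_sub_le ((z.1 - a T) / r) ((z.1 - X T x₀ ω₀) / r)
      rw [← sub_div, abs_div, abs_of_pos hr, sub_sub_sub_cancel_left,
        abs_sub_comm (X T x₀ ω₀)] at e1
      have e2 := (le_abs_self _).trans e1
      have e3 : 4 * (|a T - X T x₀ ω₀| / r) ≤ 4 * (η / r) := by
        gcongr; exact haX T ⟨hT.le, le_rfl⟩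
      have e4 : 4 * (η / r) = 4 / r * η := by ring
      linarith
    rw [integral_add (hDi _) (hχi.const_mul _), integral_const_mul, hmT] at hcmp
    linarith
  have hlim : Tendsto (fun η : ℝ => (K₀ + 4 / r * m * ((L * ε + c * η) * T + η)) *
      exp (4 * c * T) + 4 / r * η * m) (nhdsWithin 0 (Ioi 0))
      (nhds ((K₀ + 4 / r * m * (L * ε * T)) * exp (4 * c * T))) :=
    (Continuous.tendsto' (by fun_prop) _ _ (by simp)).mono_left nhdsWithin_le_nhds
  exact ge_of_tendsto hlim (eventually_nhdsWithin_of_forall main)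

end

lemma exists_smooth_partition {ε : ℝ} (hε : 0 < ε) (R : ℝ) :
    ∃ (n : ℕ) (χ : ℕ → ℝ → ℝ) (w : ℕ → ℝ), (∀ k, ContDiff ℝ 1 (χ k)) ∧
      (∀ k, HasCompactSupport (χ k)) ∧ (∀ k ω, 0 ≤ χ k ω) ∧
      (∀ k ω, χ k ω ≠ 0 → |ω - w k| ≤ ε) ∧
      (∀ ω, ∑ k ∈ Finset.range n, χ k ω ≤ 1) ∧
      (∀ ω, |ω| ≤ R → ∑ k ∈ Finset.range n, χ k ω = 1) := by
  obtain ⟨N, hN⟩ := exists_nat_ge (R / ε + 1)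
  let f : ℝ → ℕ → ℝ := fun ω k => smoothTransition (ω / ε + N - k)
  let χ : ℕ → ℝ → ℝ := fun k ω => f ω k - f ω (k + 1)
  have hsupp : ∀ k ω, χ k ω ≠ 0 → |ω - ε * (k - N + 1)| ≤ ε := by
    intro k ω hχ
    have h1 : 0 < ω / ε + N - k := by
      by_contra hle
      apply hχ
      simp only [χ, f]
      rw [smoothTransition.zero_of_nonpos (not_lt.1 hle), smoothTransition.zero_of_nonpos, sub_zero]
      push_cast
      linarith
    have h2 : ω / ε + N - k < 2 := by
      by_contra hle
      apply hχ
      simp only [χ, f]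
      rw [smoothTransition.one_of_one_le, smoothTransition.one_of_one_le, sub_self]
      · push_cast; linarith
      · linarith
    have h3 : ω - ε * (k - N + 1) = ε * (ω / ε + N - k - 1) := by field_simp; ring
    rw [h3, abs_mul, abs_of_pos hε]
    calc ε * |ω / ε + N - k - 1| ≤ ε * 1 := by
          gcongr
          rw [abs_le]
          constructor <;> linarith
      _ = ε := mul_one ε
  have hsum : ∀ ω, ∑ k ∈ Finset.range (2 * N), χ k ω = f ω 0 - f ω (2 * N) := fun ω =>
    Finset.sum_range_sub' (f ω) (2 * N)
  refine ⟨2 * N, χ, fun k => ε * (k - N + 1), fun k => ?_, fun k => ?_, fun k ω => ?_, hsupp,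
    fun ω => ?_, fun ω hω => ?_⟩
  · exact (smoothTransition.contDiff.comp (by fun_prop)).sub
      (smoothTransition.contDiff.comp (by fun_prop))
  · refine HasCompactSupport.intro (isCompact_closedBall (ε * (k - N + 1) : ℝ) ε) fun ω hω => ?_
    by_contra hne
    exact hω (by simpa [Real.dist_eq] using hsupp k ω hne)
  · refine sub_nonneg.2 (smoothTransition.monotone ?_)
    push_cast
    linarith
  · rw [hsum]
    have h1 := smoothTransition.le_one (ω / ε + N - (0 : ℕ))
    have h2 := smoothTransition.nonneg (ω / ε + N - (2 * N : ℕ))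
    simp only [f]
    linarith
  · have h1 : |ω / ε| ≤ R / ε := by rw [abs_div, abs_of_pos hε]; gcongr
    have h2 := abs_le.1 h1
    rw [hsum]
    simp only [f]
    rw [smoothTransition.one_of_one_le, smoothTransition.zero_of_nonpos, sub_zero]
    · push_cast; linarith
    · push_cast; linarith

section

variable {F : Measure (ℝ × ℝ) → ℝ × ℝ → ℝ} {μ : ℝ → Measure (ℝ × ℝ)} {X : ℝ → ℝ → ℝ → ℝ}
  {c L : ℝ} {ν : Measure ℝ}

lemma LipFlow.cell_estimate (h : LipFlow (fun t => F (μ t)) X c L) (hsol : IsSol F μ)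
    (hprob : ∀ t, 0 ≤ t → IsProbabilityMeasure (μ t)) (hF : ∀ t, 0 ≤ t → Continuous (F (μ t)))
    (hmarg : ∀ t, 0 ≤ t → (μ t).map Prod.snd = ν) {G₀ : ℝ → ℝ} (hG₀ : Measurable G₀)
    (hinit : μ 0 = ν.map fun ω => (G₀ ω, ω)) {T : ℝ} (hT : 0 < T)
    {χ : ℝ → ℝ} (hχ : ContDiff ℝ 1 χ) (hχc : HasCompactSupport χ) (hχ0 : ∀ ω, 0 ≤ χ ω)
    {x₀ ω₀ ε : ℝ} (hε : ∀ ω, χ ω ≠ 0 → |ω - ω₀| ≤ ε)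
    {g : ℝ → ℝ} (hg : Integrable g ν) (hg1 : ∀ ω, χ ω ≠ 0 → |G₀ ω - x₀| ≤ g ω)
    (hg2 : ∀ ω, ε ≤ g ω) :
    ∫ z, (1 - quarticBump (z.1 - X T (G₀ z.2) z.2)) * χ z.2 ∂(μ T) ≤
      (4 * (1 + L * T) * exp (4 * c * T) + 8 * flowConst c L T) * ∫ ω, g ω * χ ω ∂ν := by
  have hL0 := h.L_nonneg
  have hC := flowConst_nonneg h.c_pos hL0 T
  have tube := h.tube_estimate hsol hprob hF hmarg x₀ ω₀ hT hχ hχc hχ0 hε one_pos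
  simp only [div_one] at tube
  have := hprob T hT.le
  obtain ⟨B, hB⟩ := hχc.exists_bound_of_continuous hχ.continuous
  have hgχ : Integrable (fun ω => g ω * χ ω) ν :=
    hg.mul_bdd hχ.continuous.aestronglyMeasurable (Eventually.of_forall hB)
  have hνp : IsProbabilityMeasure ν := by
    rw [← hmarg T hT.le]
    exact Measure.isProbabilityMeasure_map measurable_snd.aemeasurable
  have hbump : ∀ y, 1 - quarticBump y ≤ 4 * |y| := fun y => by
    have := (le_abs_self _).trans (abs_quarticBump_sub_le 0 y)
    rwa [quarticBump_zero, zero_sub, abs_neg] at this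
  set J : ℝ := ∫ ω, g ω * χ ω ∂ν with hJ
  have hI1 : ∫ z, (1 - quarticBump (z.1 - x₀)) * χ z.2 ∂(μ 0) ≤ 4 * J := by
    have hcont : Continuous fun z : ℝ × ℝ => (1 - quarticBump (z.1 - x₀)) * χ z.2 := by
      have := continuous_quarticBump
      have := hχ.continuous
      fun_prop
    have hgm : Measurable fun ω => (G₀ ω, ω) := hG₀.prodMk measurable_id
    rw [hinit, integral_map hgm.aemeasurable hcont.aestronglyMeasurable,
      hJ, ← integral_const_mul]
    refine integral_mono_of_nonneg (Eventually.of_forall fun ω =>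
      mul_nonneg (sub_nonneg.2 (quarticBump_le_one _)) (hχ0 _)) (hgχ.const_mul 4)
      (Eventually.of_forall fun ω => ?_)
    simp only
    rw [← mul_assoc]
    by_cases hω : χ ω = 0
    · simp [hω]
    · exact mul_le_mul_of_nonneg_right ((hbump _).trans (by gcongr; exact hg1 ω hω)) (hχ0 _)
  have hI2 : ε * ∫ ω, χ ω ∂ν ≤ J := by
    rw [hJ, ← integral_const_mul]
    exact integral_mono ((hχ.continuous.integrable_of_hasCompactSupport hχc).const_mul ε) hgχ
      fun ω => mul_le_mul_of_nonneg_right (hg2 ω) (hχ0 ω)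
  have hgχ2 : Integrable (fun z : ℝ × ℝ => g z.2 * χ z.2) (μ T) := by
    rw [← hmarg T hT.le] at hgχ
    exact hgχ.comp_measurable measurable_snd
  have hgχ3 : ∫ z, g z.2 * χ z.2 ∂(μ T) = J := by
    rw [hJ, ← hmarg T hT.le, integral_map measurable_snd.aemeasurable]
    rw [hmarg T hT.le]
    exact hgχ.aestronglyMeasurable
  have hDi : Integrable (fun z : ℝ × ℝ => (1 - quarticBump (z.1 - X T x₀ ω₀)) * χ z.2) (μ T) := by
    simpa using integrable_mul_comp_snd (ρ := μ T) (f := fun y => 1 - quarticBump y)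
      hχ.continuous hχc (continuous_const.sub continuous_quarticBump) (fun y => by
        have := quarticBump_nonneg y
        rw [abs_of_nonneg (sub_nonneg.2 (quarticBump_le_one _))]
        linarith) (X T x₀ ω₀) 1
  have hI3 : ∫ z, (1 - quarticBump (z.1 - X T (G₀ z.2) z.2)) * χ z.2 ∂(μ T) ≤
      ∫ z, ((1 - quarticBump (z.1 - X T x₀ ω₀)) * χ z.2 +
        8 * flowConst c L T * (g z.2 * χ z.2)) ∂(μ T) := by
    refine integral_mono_of_nonneg (Eventually.of_forall fun z =>
      mul_nonneg (sub_nonneg.2 (quarticBump_le_one _)) (hχ0 _)) (hDi.add (hgχ2.const_mul _))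
      (Eventually.of_forall fun z => ?_)
    simp only
    rw [← mul_assoc, ← add_mul]
    by_cases hω : χ z.2 = 0
    · simp [hω]
    refine mul_le_mul_of_nonneg_right ?_ (hχ0 _)
    have e1 := (le_abs_self _).trans
      (abs_quarticBump_sub_le (z.1 - X T x₀ ω₀) (z.1 - X T (G₀ z.2) z.2))
    rw [sub_sub_sub_cancel_left] at e1
    have e2 := h.abs_sub_le ⟨hT.le, le_rfl⟩ (G₀ z.2) z.2 x₀ ω₀
    have e3 : flowConst c L T * (|G₀ z.2 - x₀| + |z.2 - ω₀|) ≤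
        flowConst c L T * (g z.2 + g z.2) := by
      gcongr
      · exact hg1 _ hω
      · exact (hε _ hω).trans (hg2 _)
    linarith
  rw [integral_add hDi (hgχ2.const_mul _), integral_const_mul, hgχ3] at hI3
  have hT0 := hT.le
  calc _ ≤ _ := hI3
    _ ≤ (4 * J + 4 * (L * T) * J) * exp (4 * c * T) + 8 * flowConst c L T * J := by
      gcongr
      refine tube.trans ?_
      gcongr ?_ * _
      refine add_le_add hI1 ?_
      calc _ = 4 * (L * T) * (ε * ∫ ω, χ ω ∂ν) := by ring
        _ ≤ _ := by gcongr
    _ = _ := by ring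

lemma LipFlow.ae_eq_graph (h : LipFlow (fun t => F (μ t)) X c L) (hsol : IsSol F μ)
    (hprob : ∀ t, 0 ≤ t → IsProbabilityMeasure (μ t)) (hF : ∀ t, 0 ≤ t → Continuous (F (μ t)))
    (hmarg : ∀ t, 0 ≤ t → (μ t).map Prod.snd = ν) {G₀ : ℝ → ℝ} (hG₀ : Measurable G₀)
    (hG₀i : Integrable G₀ ν) (hinit : μ 0 = ν.map fun ω => (G₀ ω, ω)) {T : ℝ} (hT : 0 < T) :
    ∀ᵐ z ∂(μ T), z.1 = X T (G₀ z.2) z.2 := by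
  have := hprob T hT.le
  have hνp : IsProbabilityMeasure ν := by
    rw [← hmarg T hT.le]
    exact Measure.isProbabilityMeasure_map measurable_snd.aemeasurable
  have hL0 := h.L_nonneg
  have hC := flowConst_nonneg h.c_pos hL0 T
  set f : ℝ × ℝ → ℝ := fun z => 1 - quarticBump (z.1 - X T (G₀ z.2) z.2) with hf
  have hf0 : ∀ z, 0 ≤ f z := fun z => sub_nonneg.2 (quarticBump_le_one _)
  have hfm : Measurable f := by
    have h1 : Measurable fun z : ℝ × ℝ => X T (G₀ z.2) z.2 :=
      (h.continuous hT.le).measurable.comp ((hG₀.comp measurable_snd).prodMk measurable_snd)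
    exact measurable_const.sub (continuous_quarticBump.measurable.comp (measurable_fst.sub h1))
  have hf1 : ∀ z, ‖f z‖ ≤ 1 := fun z => by
    rw [Real.norm_of_nonneg (hf0 z)]
    have := quarticBump_nonneg (z.1 - X T (G₀ z.2) z.2)
    simp only [hf]
    linarith
  have hfi : Integrable f (μ T) := Integrable.of_bound hfm.aestronglyMeasurable 1
    (Eventually.of_forall hf1)
  set Q : ℝ := 4 * (1 + L * T) * exp (4 * c * T) + 8 * flowConst c L T with hQ
  have hQ0 : 0 ≤ Q := by
    have := hT.le
    positivity
  have hwin : ∀ R : ℝ, ∫ z in {z : ℝ × ℝ | |z.2| ≤ R}, f z ∂(μ T) ≤ 0 := by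
    intro R
    have hRm : MeasurableSet {z : ℝ × ℝ | |z.2| ≤ R} :=
      measurableSet_le (by fun_prop) measurable_const
    have hδ : ∀ δ : ℝ, 0 < δ → ∫ z in {z : ℝ × ℝ | |z.2| ≤ R}, f z ∂(μ T) ≤ Q * (δ + 2 * δ) := by
      intro δ hδ
      obtain ⟨Ĝ, hĜs, hĜ, hĜc, hĜi⟩ := hG₀i.exists_hasCompactSupport_integral_sub_le hδ
      obtain ⟨ε₀, hε₀, hunif⟩ := Metric.uniformContinuous_iff.1
        (hĜs.uniformContinuous_of_continuous hĜc) δ hδ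
      set ε := min (ε₀ / 2) δ
      have hε : 0 < ε := lt_min (by positivity) hδ
      obtain ⟨n, χ, w, hχ, hχc, hχ0, hχw, hχ1, hχR⟩ := exists_smooth_partition hε R
      set g : ℝ → ℝ := fun ω => |G₀ ω - Ĝ ω| + 2 * δ with hg
      have hgi : Integrable g ν := (hG₀i.sub hĜi).abs.add (integrable_const _)
      have hg0 : ∀ ω, 0 ≤ g ω := fun ω => by positivity
      have hcell : ∀ k, ∫ z, f z * χ k z.2 ∂(μ T) ≤ Q * ∫ ω, g ω * χ k ω ∂ν := fun k => by
        refine h.cell_estimate hsol hprob hF hmarg hG₀ hinit hT (hχ k) (hχc k) (hχ0 k)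
          (x₀ := Ĝ (w k)) (hχw k) hgi (fun ω hω => ?_) (fun ω => ?_)
        · have e1 := hχw k ω hω
          have e2 : dist (Ĝ ω) (Ĝ (w k)) < δ := hunif (by
            rw [Real.dist_eq]
            have := min_le_left (ε₀ / 2) δ
            linarith)
          rw [Real.dist_eq] at e2
          have e3 := _root_.abs_sub_le (G₀ ω) (Ĝ ω) (Ĝ (w k))
          simp only [hg]
          linarith
        · have e1 := min_le_right (ε₀ / 2) δ
          have e2 := abs_nonneg (G₀ ω - Ĝ ω)
          simp only [hg]
          linarith
      have hbd : ∀ k, ∃ B, ∀ ω, ‖χ k ω‖ ≤ B := fun k =>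
        (hχc k).exists_bound_of_continuous (hχ k).continuous
      have hfχ : ∀ k ∈ Finset.range n, Integrable (fun z : ℝ × ℝ => f z * χ k z.2) (μ T) :=
        fun k _ => by
          obtain ⟨B, hB⟩ := hbd k
          exact hfi.mul_bdd ((hχ k).continuous.comp continuous_snd).aestronglyMeasurable
            (Eventually.of_forall fun z => hB z.2)
      have hgχ : ∀ k ∈ Finset.range n, Integrable (fun ω => g ω * χ k ω) ν := fun k _ => by
        obtain ⟨B, hB⟩ := hbd k
        exact hgi.mul_bdd (hχ k).continuous.aestronglyMeasurable (Eventually.of_forall hB)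
      calc ∫ z in {z : ℝ × ℝ | |z.2| ≤ R}, f z ∂(μ T)
          = ∫ z in {z : ℝ × ℝ | |z.2| ≤ R}, ∑ k ∈ Finset.range n, f z * χ k z.2 ∂(μ T) := by
            refine setIntegral_congr_fun hRm fun z hz => ?_
            rw [← Finset.mul_sum, hχR z.2 hz, mul_one]
        _ ≤ ∫ z, ∑ k ∈ Finset.range n, f z * χ k z.2 ∂(μ T) :=
            setIntegral_le_integral (integrable_finsetSum _ hfχ) (Eventually.of_forall fun z =>
              Finset.sum_nonneg fun k _ => mul_nonneg (hf0 z) (hχ0 k _))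
        _ = ∑ k ∈ Finset.range n, ∫ z, f z * χ k z.2 ∂(μ T) := integral_finsetSum _ hfχ
        _ ≤ ∑ k ∈ Finset.range n, Q * ∫ ω, g ω * χ k ω ∂ν := Finset.sum_le_sum fun k _ => hcell k
        _ = Q * ∫ ω, ∑ k ∈ Finset.range n, g ω * χ k ω ∂ν := by
            rw [integral_finsetSum _ hgχ, Finset.mul_sum]
        _ ≤ Q * ∫ ω, g ω ∂ν := by
            refine mul_le_mul_of_nonneg_left ?_ hQ0
            refine integral_mono (integrable_finsetSum _ hgχ) hgi fun ω => ?_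
            simp only
            rw [← Finset.mul_sum]
            exact mul_le_of_le_one_right (hg0 ω) (hχ1 ω)
        _ ≤ Q * (δ + 2 * δ) := by
            gcongr
            simp only [hg]
            have habs : Integrable (fun ω => |G₀ ω - Ĝ ω|) ν := (hG₀i.sub hĜi).abs
            rw [integral_add habs (integrable_const _)]
            have : ∫ ω, |G₀ ω - Ĝ ω| ∂ν ≤ δ := hĜ
            simpa using this
    have hlim : Tendsto (fun δ : ℝ => Q * (δ + 2 * δ)) (nhdsWithin 0 (Ioi 0)) (nhds 0) :=
      (Continuous.tendsto' (by fun_prop) _ _ (by simp)).mono_left nhdsWithin_le_nhds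
    exact ge_of_tendsto hlim (eventually_nhdsWithin_of_forall hδ)
  have hall : ∀ᵐ z ∂(μ T), ∀ n : ℕ, |z.2| ≤ (n : ℝ) → f z = 0 := by
    rw [ae_all_iff]
    intro n
    have hRm : MeasurableSet {z : ℝ × ℝ | |z.2| ≤ (n : ℝ)} :=
      measurableSet_le (by fun_prop) measurable_const
    have hz := (setIntegral_eq_zero_iff_of_nonneg_ae (Eventually.of_forall hf0)
      hfi.integrableOn).1 (le_antisymm (hwin n) (setIntegral_nonneg hRm fun z _ => hf0 z))
    exact (ae_restrict_iff' hRm).1 hz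
  filter_upwards [hall] with z hz
  obtain ⟨n, hn⟩ := exists_nat_ge |z.2|
  exact sub_eq_zero.1 (eq_zero_of_quarticBump (hz n hn))

lemma LipFlow.eq_map_graph (h : LipFlow (fun t => F (μ t)) X c L) (hsol : IsSol F μ)
    (hprob : ∀ t, 0 ≤ t → IsProbabilityMeasure (μ t)) (hF : ∀ t, 0 ≤ t → Continuous (F (μ t)))
    (hmarg : ∀ t, 0 ≤ t → (μ t).map Prod.snd = ν) {G₀ : ℝ → ℝ} (hG₀ : Measurable G₀)
    (hG₀i : Integrable G₀ ν) (hinit : μ 0 = ν.map fun ω => (G₀ ω, ω)) {t : ℝ} (ht : 0 ≤ t) :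
    μ t = ν.map fun ω => (X t (G₀ ω) ω, ω) := by
  rcases ht.eq_or_lt with rfl | hpos
  · simpa only [h.init] using hinit
  have hgm : Measurable fun ω => (X t (G₀ ω) ω, ω) :=
    ((h.continuous ht).measurable.comp (hG₀.prodMk measurable_id)).prodMk measurable_id
  conv_rhs => rw [← hmarg t ht, Measure.map_map hgm measurable_snd]
  conv_lhs => rw [← Measure.map_id (μ := μ t)]
  refine Measure.map_congr ?_
  filter_upwards [h.ae_eq_graph hsol hprob hF hmarg hG₀ hG₀i hinit hpos] with z hz
  exact Prod.ext hz rfl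

end

lemma abs_sub_le_of_abs_deriv_le {f : ℝ × ℝ → ℝ} (hf : Differentiable ℝ f) {c L : ℝ}
    (hc : ∀ z : ℝ × ℝ, |deriv (fun x => f (x, z.2)) z.1| ≤ c)
    (hL : ∀ z : ℝ × ℝ, |deriv (fun w => f (z.1, w)) z.2| ≤ L) (z z' : ℝ × ℝ) :
    |f z - f z'| ≤ c * |z.1 - z'.1| + L * |z.2 - z'.2| := by
  have h1 : |f (z.1, z.2) - f (z'.1, z.2)| ≤ c * |z.1 - z'.1| :=
    Convex.norm_image_sub_le_of_norm_deriv_le (f := fun x => f (x, z.2)) (s := univ)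
      (fun x _ => (hf.comp (differentiable_id.prodMk (differentiable_const z.2))) x)
      (fun x _ => hc (x, z.2)) convex_univ (mem_univ _) (mem_univ _)
  have h2 : |f (z'.1, z.2) - f (z'.1, z'.2)| ≤ L * |z.2 - z'.2| :=
    Convex.norm_image_sub_le_of_norm_deriv_le (f := fun w => f (z'.1, w)) (s := univ)
      (fun w _ => (hf.comp ((differentiable_const z'.1).prodMk differentiable_id)) w)
      (fun w _ => hL (z'.1, w)) convex_univ (mem_univ _) (mem_univ _)
  exact (abs_sub_le _ (f (z'.1, z.2)) _).trans (add_le_add h1 h2)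

lemma Framework.contDiff_one {ν : Measure ℝ} {F : Measure (ℝ × ℝ) → ℝ × ℝ → ℝ}
    {A B I M κ γ : ℝ} (hF : Framework ν F A B I M κ γ) {ρ : Measure (ℝ × ℝ)} (hρ : ρ ∈ P2nu ν) :
    ContDiff ℝ 1 (F ρ) :=
  (hF.hA2 ρ hρ).1.of_le (by norm_num)

lemma Framework.lipFlow {ν : Measure ℝ} {F : Measure (ℝ × ℝ) → ℝ × ℝ → ℝ}
    {A B I M κ γ : ℝ} (hF : Framework ν F A B I M κ γ) (hκ : 0 < κ) (hI : 0 < I)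
    {μ : ℝ → Measure (ℝ × ℝ)} (hP : ∀ t, 0 ≤ t → μ t ∈ P2nu ν)
    {X : ℝ → ℝ → ℝ → ℝ} (hX : IsFlow F μ X) : LipFlow (fun t => F (μ t)) X (κ * I) I where
  c_pos := mul_pos hκ hI
  L_nonneg := hI.le
  lip t ht := abs_sub_le_of_abs_deriv_le ((hF.contDiff_one (hP t ht)).differentiable one_ne_zero)
    (hF.hA2 _ (hP t ht)).2.1 (hF.hA2 _ (hP t ht)).2.2.2
  init := hX.1
  ode x ω t ht := hX.2 x ω t ht

lemma integrable_of_map_graph_mem_P2nu {ν : Measure ℝ} [IsProbabilityMeasure ν] {G : ℝ → ℝ}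
    (hG : Measurable G) (h : (ν.map fun ω => (G ω, ω)) ∈ P2nu ν) : Integrable G ν := by
  have hgm : Measurable fun ω => (G ω, ω) := hG.prodMk measurable_id
  refine ((integrable_const (1:ℝ)).add (h.2.1.comp_measurable hgm)).mono'
    hG.aestronglyMeasurable (Eventually.of_forall fun ω => ?_)
  have h2 : G ω ^ 2 = |G ω| ^ 2 := (sq_abs _).symm
  simp only [Pi.add_apply, Function.comp_apply, Real.norm_eq_abs, h2]
  nlinarith [sq_nonneg (|G ω| - 1), sq_nonneg ω, abs_nonneg (G ω)]

/-- Propagation of graph measures: if the initial datum is a Borel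
graph measure `μ₀ = (G₀ ⊗ Id)_♯ ν`, then for every `t ≥ 0` the solution `μ_t` is the
graph measure `μ_t = (G_t ⊗ Id)_♯ ν` with `G_t(ω) = X(t, G₀(ω), ω)` (`X` the
characteristic flow), `G_t` being Borel; and if `G₀` is continuous (resp. `C¹`) on `Ω`
then so is `G_t`. -/
theorem graph_measure_propagation
    (ν : Measure ℝ) [IsProbabilityMeasure ν]
    (hΩ : Bornology.IsBounded (msupp ν))
    (A B I M κ γ : ℝ)
    (hpos : 0 < A ∧ 0 < B ∧ 0 < I ∧ 0 < M ∧ 0 < κ ∧ 0 < γ)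
    (hγ : γ = sSup {d : ℝ | ∃ ω ∈ msupp ν, ∃ ω' ∈ msupp ν, d = |ω - ω'|})
    (F : Measure (ℝ × ℝ) → ℝ × ℝ → ℝ) (hF : Framework ν F A B I M κ γ)
    (μ : ℝ → Measure (ℝ × ℝ)) (hsol : IsSol F μ)
    (hP : ∀ t : ℝ, 0 ≤ t → μ t ∈ P2nu ν)
    (X : ℝ → ℝ → ℝ → ℝ) (hX : IsFlow F μ X)
    (G₀ : ℝ → ℝ) (hG₀ : Measurable G₀)
    (hinit : μ 0 = ν.map fun ω => (G₀ ω, ω)) :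
    ∀ t : ℝ, 0 ≤ t →
      (Measurable fun ω => X t (G₀ ω) ω) ∧
      (μ t = ν.map fun ω => (X t (G₀ ω) ω, ω)) ∧
      (ContinuousOn G₀ (msupp ν) →
        ContinuousOn (fun ω => X t (G₀ ω) ω) (msupp ν)) ∧
      (ContDiffOn ℝ 1 G₀ (msupp ν) →
        ContDiffOn ℝ 1 (fun ω => X t (G₀ ω) ω) (msupp ν)) := by
  have hprob : ∀ t, 0 ≤ t → IsProbabilityMeasure (μ t) := fun t ht => (hP t ht).1
  have hC1 : ∀ t, 0 ≤ t → ContDiff ℝ 1 (F (μ t)) := fun t ht => hF.contDiff_one (hP t ht)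
  have h := hF.lipFlow hpos.2.2.2.2.1 hpos.2.2.1 hP hX
  have hG₀i : Integrable G₀ ν :=
    integrable_of_map_graph_mem_P2nu hG₀ (hinit ▸ hP 0 le_rfl)
  intro t ht
  refine ⟨(h.continuous ht).measurable.comp (hG₀.prodMk measurable_id),
    h.eq_map_graph hsol hprob (fun s hs => (hC1 s hs).continuous) (fun s hs => (hP s hs).2.2)
      hG₀ hG₀i hinit ht, fun hG => ?_, fun hG => ?_⟩
  · exact (h.continuous ht).comp_continuousOn (hG.prodMk continuousOn_id)
  · exact (h.contDiff hC1 ht).comp_contDiffOn (hG.prodMk contDiffOn_id)
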